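/- arXiv:2012.07481 — 2 statements merged into one kernel-verified Lean document; each statement's English description precedes it below -/
import Mathlib

section
/- Let h_t be a C¹ flow on the two-torus 𝕋² without critical points and without periodic orbits. Then there exists a smooth closed curve γ transverse to the flow: a C¹ embedding γ : 𝕊¹ → 𝕋² whose tangent vector is at every point linearly independent of the generating vector field of the flow, such that every orbit of h_t intersects the image of γ. Consequently the first return time u(x) = inf{t > 0 : h_t(x) ∈ γ(𝕊¹)} is finite, positive and C¹ on γ(𝕊¹), bounded and bounded away from 0, and the first return map R(x) = h_{u(x)}(x) is a well-defined C¹ diffeomorphism of γ(𝕊¹). -/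
open MeasureTheory Set
noncomputable section

/-- The two-torus `𝕋² = ℝ²/ℤ²`. -/
abbrev T2 : Type := AddCircle (1:ℝ) × AddCircle (1:ℝ)

/-- Projection `ℝ² → 𝕋²`. -/
def projT2 (v : ℝ × ℝ) : T2 := (↑v.1, ↑v.2)

/-- A `C¹` flow on the two-torus, encoded by a jointly `C¹` lift to ℝ². -/
structure C1FlowT2 where
  flow : ℝ → T2 → T2
  lift : ℝ → ℝ × ℝ → ℝ × ℝ
  lift_contDiff : ContDiff ℝ 1 (Function.uncurry lift)
  lift_proj : ∀ t v, projT2 (lift t v) = flow t (projT2 v)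
  flow_zero : ∀ x, flow 0 x = x
  flow_add : ∀ t s x, flow (t + s) x = flow t (flow s x)

namespace C1FlowT2
/-- The generating vector field of the flow (read in the universal cover). -/
def vf (h : C1FlowT2) (v : ℝ × ℝ) : ℝ × ℝ := deriv (fun t => h.lift t v) 0
/-- The flow has no critical points: its generating vector field never vanishes. -/
def NoCriticalPoints (h : C1FlowT2) : Prop := ∀ v, h.vf v ≠ 0
/-- The flow has no periodic orbits. -/
def NoPeriodicOrbits (h : C1FlowT2) : Prop := ∀ x T, 0 < T → h.flow T x ≠ x
end C1FlowT2

/-- A closed transversal curve of the flow: a `C¹` embedded circle, everywhere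
transverse to the generating vector field, meeting every orbit. -/
structure ClosedTransversal (h : C1FlowT2) where
  γ : AddCircle (1:ℝ) → T2
  lift : ℝ → ℝ × ℝ
  lift_contDiff : ContDiff ℝ 1 lift
  lift_proj : ∀ s : ℝ, projT2 (lift s) = γ ↑s
  inj : Function.Injective γ
  transverse : ∀ s : ℝ,
    (deriv lift s).1 * (h.vf (lift s)).2 - (deriv lift s).2 * (h.vf (lift s)).1 ≠ 0
  meets : ∀ x : T2, ∃ t : ℝ, h.flow t x ∈ Set.range γ

/-- First return time to the transversal: `u x = inf {t > 0 | h_t x ∈ γ(𝕊¹)}`. -/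
def returnTime (h : C1FlowT2) (Γ : ClosedTransversal h) (x : T2) : ℝ :=
  sInf {t : ℝ | 0 < t ∧ h.flow t x ∈ Set.range Γ.γ}

/-- `F : CircleDeg1Lift` is a lift of the first return map of the flow to the
transversal `Γ`, read in the parametrization of `Γ` by the circle. -/
def ReturnMapLift (h : C1FlowT2) (Γ : ClosedTransversal h) (F : CircleDeg1Lift) : Prop :=
  ∀ s : ℝ, Γ.γ ↑(F s) = h.flow (returnTime h Γ (Γ.γ ↑s)) (Γ.γ ↑s)

/-- A real number is of constant type if it is irrational and the partial quotients
of its continued fraction expansion are bounded. -/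
def IsOfConstantType (ω : ℝ) : Prop :=
  Irrational ω ∧ ∃ B : ℝ, ∀ n : ℕ, ∀ a ∈ (GenContFract.of ω).partDens.get? n, a ≤ B

/-- `C¹` norm of an observable on the torus. -/
def C1Norm (f : T2 → ℝ) : ℝ :=
  (⨆ v : ℝ × ℝ, |f (projT2 v)|) + ⨆ v : ℝ × ℝ, ‖fderiv ℝ (fun w => f (projT2 w)) v‖

/-- Ergodic integral `H_{x,T}(f) = ∫₀^T f(h_t x) dt`. -/
def ergInt (h : C1FlowT2) (f : T2 → ℝ) (x : T2) (T : ℝ) : ℝ :=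
  ∫ t in (0:ℝ)..T, f (h.flow t x)

/-- The plane vector with integer coordinates `k`. -/
def intVec (k : ℤ × ℤ) : ℝ × ℝ := (k.1, k.2)

/-- The determinant of two plane vectors. -/
def cross (u w : ℝ × ℝ) : ℝ := u.1 * w.2 - u.2 * w.1

@[simp] lemma intVec_zero : intVec 0 = 0 := by simp [intVec]

lemma intVec_sub (k l : ℤ × ℤ) : intVec (k - l) = intVec k - intVec l := by
  simp [intVec]

lemma intVec_neg (k : ℤ × ℤ) : intVec (-k) = -intVec k := by
  simp [intVec]

lemma projT2_eq_iff {v w : ℝ × ℝ} : projT2 v = projT2 w ↔ ∃ k : ℤ × ℤ, v = w + intVec k := by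
  simp only [projT2, Prod.ext_iff, intVec, Prod.exists,
    Prod.fst_add, Prod.snd_add]
  have key : ∀ a b : ℝ, ((a : AddCircle (1 : ℝ)) = b) ↔ ∃ m : ℤ, a = b + m := by
    intro a b
    rw [← sub_eq_zero, ← AddCircle.coe_sub, AddCircle.coe_eq_zero_iff]
    constructor
    · rintro ⟨m, hm⟩
      exact ⟨m, by simp at hm; linarith⟩
    · rintro ⟨m, hm⟩
      exact ⟨m, by simp; linarith⟩
  rw [key, key]
  constructor
  · rintro ⟨⟨a, ha⟩, b, hb⟩
    exact ⟨a, b, ha, hb⟩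
  · rintro ⟨a, b, ha, hb⟩
    exact ⟨⟨a, ha⟩, b, hb⟩

lemma projT2_add_intVec (v : ℝ × ℝ) (k : ℤ × ℤ) : projT2 (v + intVec k) = projT2 v :=
  projT2_eq_iff.2 ⟨k, rfl⟩

lemma projT2_sub_intVec (v : ℝ × ℝ) (k : ℤ × ℤ) : projT2 (v - intVec k) = projT2 v :=
  projT2_eq_iff.2 ⟨-k, by rw [intVec_neg, sub_eq_add_neg]⟩

lemma projT2_surjective : Function.Surjective projT2 := by
  rintro ⟨x, y⟩
  induction x using QuotientAddGroup.induction_on with | H a => ?_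
  induction y using QuotientAddGroup.induction_on with | H b => ?_
  exact ⟨(a, b), rfl⟩

/-- Continuous lifts of the same map to the torus which agree at one point are equal. -/
lemma eq_of_projT2_eq {A : Type*} [TopologicalSpace A] [PreconnectedSpace A] {f g : A → ℝ × ℝ}
    (hf : Continuous f) (hg : Continuous g) (hfg : ∀ a, projT2 (f a) = projT2 (g a))
    (a₀ : A) (h₀ : f a₀ = g a₀) : f = g := by
  have hc := AddCircle.isCoveringMap_coe (1 : ℝ)
  have h1 := hc.eq_of_comp_eq hf.fst hg.fst (funext fun a => congrArg Prod.fst (hfg a)) a₀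
    (congrArg Prod.fst h₀)
  have h2 := hc.eq_of_comp_eq hf.snd hg.snd (funext fun a => congrArg Prod.snd (hfg a)) a₀
    (congrArg Prod.snd h₀)
  funext a
  exact Prod.ext (congrFun h1 a) (congrFun h2 a)

lemma hasDerivAt_prod_fst {c : ℝ → ℝ × ℝ} {c' : ℝ × ℝ} {r : ℝ} (hc : HasDerivAt c c' r) :
    HasDerivAt (fun r => (c r).1) c'.1 r :=
  (hasFDerivAt_fst (𝕜 := ℝ) (p := c r)).comp_hasDerivAt r hc

lemma hasDerivAt_prod_snd {c : ℝ → ℝ × ℝ} {c' : ℝ × ℝ} {r : ℝ} (hc : HasDerivAt c c' r) :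
    HasDerivAt (fun r => (c r).2) c'.2 r :=
  (hasFDerivAt_snd (𝕜 := ℝ) (p := c r)).comp_hasDerivAt r hc

lemma cross_map (A : ℝ × ℝ →L[ℝ] ℝ × ℝ) (u w : ℝ × ℝ) :
    cross (A u) (A w) = cross (A (1, 0)) (A (0, 1)) * cross u w := by
  have h : ∀ v : ℝ × ℝ, A v = v.1 • A (1, 0) + v.2 • A (0, 1) := by
    intro v
    rw [← map_smul, ← map_smul, ← map_add]
    simp
  rw [h u, h w]
  simp only [cross, Prod.fst_add, Prod.snd_add, Prod.smul_fst, Prod.smul_snd, smul_eq_mul]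
  ring

lemma cross_map_ne_zero {A B : ℝ × ℝ →L[ℝ] ℝ × ℝ} (hBA : ∀ u, B (A u) = u) {u w : ℝ × ℝ}
    (h : cross u w ≠ 0) : cross (A u) (A w) ≠ 0 := by
  intro h0
  have := cross_map B (A u) (A w)
  rw [hBA, hBA, h0, mul_zero] at this
  exact h this

namespace C1FlowT2

variable (h : C1FlowT2)

/-- The lift of the flow to the plane which is the identity at time `0`. -/
def planeFlow (t : ℝ) (v : ℝ × ℝ) : ℝ × ℝ := h.lift t v - h.lift 0 0

lemma contDiff_planeFlow : ContDiff ℝ 1 (fun p : ℝ × (ℝ × ℝ) => h.planeFlow p.1 p.2) :=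
  h.lift_contDiff.sub contDiff_const

lemma continuous_planeFlow : Continuous (fun p : ℝ × (ℝ × ℝ) => h.planeFlow p.1 p.2) :=
  h.contDiff_planeFlow.continuous

lemma projT2_planeFlow (t : ℝ) (v : ℝ × ℝ) : projT2 (h.planeFlow t v) = h.flow t (projT2 v) := by
  have h0 : projT2 (h.lift 0 0) = projT2 0 := by rw [h.lift_proj, h.flow_zero]
  obtain ⟨k, hk⟩ := projT2_eq_iff.1 h0
  rw [planeFlow, hk, zero_add, projT2_sub_intVec, h.lift_proj]

lemma planeFlow_zero (v : ℝ × ℝ) : h.planeFlow 0 v = v := by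
  have hc : Continuous (fun v => h.planeFlow 0 v) :=
    h.continuous_planeFlow.comp (by fun_prop : Continuous fun v : ℝ × ℝ => ((0 : ℝ), v))
  exact congrFun (eq_of_projT2_eq hc continuous_id
    (fun v => by rw [h.projT2_planeFlow, h.flow_zero]; rfl) 0 (by simp [planeFlow])) v

lemma planeFlow_add (t s : ℝ) (v : ℝ × ℝ) :
    h.planeFlow (t + s) v = h.planeFlow t (h.planeFlow s v) := by
  have hc := h.continuous_planeFlow
  have h1 : Continuous fun p : ℝ × ℝ × (ℝ × ℝ) => h.planeFlow (p.1 + p.2.1) p.2.2 :=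
    hc.comp (by fun_prop : Continuous fun p : ℝ × ℝ × (ℝ × ℝ) => (p.1 + p.2.1, p.2.2))
  have h2 : Continuous fun p : ℝ × ℝ × (ℝ × ℝ) => h.planeFlow p.2.1 p.2.2 :=
    hc.comp (by fun_prop : Continuous fun p : ℝ × ℝ × (ℝ × ℝ) => (p.2.1, p.2.2))
  have h3 : Continuous fun p : ℝ × ℝ × (ℝ × ℝ) => h.planeFlow p.1 (h.planeFlow p.2.1 p.2.2) :=
    hc.comp (continuous_fst.prodMk h2)
  exact congrFun (eq_of_projT2_eq h1 h3
    (fun p => by simp only [h.projT2_planeFlow, h.flow_add]) (0, 0, 0)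
    (by simp only [h.planeFlow_zero, add_zero])) (t, s, v)

lemma planeFlow_neg_self (t : ℝ) (v : ℝ × ℝ) : h.planeFlow (-t) (h.planeFlow t v) = v := by
  rw [← h.planeFlow_add, neg_add_cancel, h.planeFlow_zero]

lemma planeFlow_add_intVec (t : ℝ) (v : ℝ × ℝ) (k : ℤ × ℤ) :
    h.planeFlow t (v + intVec k) = h.planeFlow t v + intVec k := by
  have hc := h.continuous_planeFlow
  have h1 : Continuous fun t : ℝ => h.planeFlow t (v + intVec k) :=
    hc.comp (by fun_prop : Continuous fun t : ℝ => (t, v + intVec k))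
  have h2 : Continuous fun t : ℝ => h.planeFlow t v :=
    hc.comp (by fun_prop : Continuous fun t : ℝ => (t, v))
  have h3 : Continuous fun t : ℝ => h.planeFlow t v + intVec k := h2.add continuous_const
  exact congrFun (eq_of_projT2_eq h1 h3
    (fun t => by simp only [projT2_add_intVec, h.projT2_planeFlow]) 0
    (by simp only [h.planeFlow_zero])) t

lemma planeFlow_sub_intVec (t : ℝ) (v : ℝ × ℝ) (k : ℤ × ℤ) :
    h.planeFlow t (v - intVec k) = h.planeFlow t v - intVec k := by
  have := h.planeFlow_add_intVec t v (-k)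
  rwa [intVec_neg, ← sub_eq_add_neg, ← sub_eq_add_neg] at this

lemma hasDerivAt_planeFlow (t : ℝ) (v : ℝ × ℝ) :
    HasDerivAt (fun s => h.planeFlow s v) (h.vf (h.planeFlow t v)) t := by
  have hd : ∀ w, DifferentiableAt ℝ (fun s => h.lift s w) 0 := by
    intro w
    have := h.lift_contDiff.differentiable one_ne_zero
    exact (this.comp (by fun_prop : Differentiable ℝ fun s : ℝ => (s, w))) 0
  have h0 : ∀ w, HasDerivAt (fun s => h.planeFlow s w) (h.vf w) 0 := fun w =>
    (hd w).hasDerivAt.sub_const _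
  have h1 := (h0 (h.planeFlow t v))
  have h2 : HasDerivAt (fun s => h.planeFlow (s - t) (h.planeFlow t v))
      (h.vf (h.planeFlow t v)) t := by
    have h1' : HasDerivAt (fun s => h.planeFlow s (h.planeFlow t v)) (h.vf (h.planeFlow t v))
      (t - t) := by simpa using h1
    exact h1'.comp_sub_const t t
  refine h2.congr_of_eventuallyEq (Filter.Eventually.of_forall fun s => ?_)
  simp only [← h.planeFlow_add, sub_add_cancel]

lemma vf_eq_fderiv (v : ℝ × ℝ) :
    h.vf v = fderiv ℝ (fun p : ℝ × (ℝ × ℝ) => h.planeFlow p.1 p.2) (0, v) (1, 0) := by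
  have h1 := ((h.contDiff_planeFlow.differentiable one_ne_zero) (0, v)).hasFDerivAt
  have h2 : HasDerivAt (fun s : ℝ => (s, v)) ((1 : ℝ), (0 : ℝ × ℝ)) 0 :=
    (hasDerivAt_id (0 : ℝ)).prodMk (hasDerivAt_const _ _)
  have h3 := h1.comp_hasDerivAt (0 : ℝ) h2
  have h4 := h.hasDerivAt_planeFlow 0 v
  rw [h.planeFlow_zero] at h4
  exact h4.unique h3

lemma continuous_vf : Continuous h.vf := by
  have : h.vf = fun v =>
      fderiv ℝ (fun p : ℝ × (ℝ × ℝ) => h.planeFlow p.1 p.2) (0, v) (1, 0) :=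
    funext h.vf_eq_fderiv
  rw [this]
  have hc := h.contDiff_planeFlow.continuous_fderiv one_ne_zero
  exact (hc.comp (by fun_prop : Continuous fun v : ℝ × ℝ => ((0 : ℝ), v))).clm_apply
    continuous_const

lemma vf_add_intVec (v : ℝ × ℝ) (k : ℤ × ℤ) : h.vf (v + intVec k) = h.vf v := by
  have h1 := h.hasDerivAt_planeFlow 0 (v + intVec k)
  have h2 := h.hasDerivAt_planeFlow 0 v
  simp only [h.planeFlow_add_intVec, h.planeFlow_zero] at h1 h2
  exact h1.unique (h2.add_const _)

/-- The space derivative of the flow. -/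
def flowDeriv (t : ℝ) (v : ℝ × ℝ) : ℝ × ℝ →L[ℝ] ℝ × ℝ := fderiv ℝ (h.planeFlow t) v

lemma hasFDerivAt_planeFlow (t : ℝ) (v : ℝ × ℝ) :
    HasFDerivAt (h.planeFlow t) (h.flowDeriv t v) v := by
  have hd : Differentiable ℝ (h.planeFlow t) :=
    (h.contDiff_planeFlow.differentiable one_ne_zero).comp
      (by fun_prop : Differentiable ℝ fun v : ℝ × ℝ => (t, v))
  exact (hd v).hasFDerivAt

lemma flowDeriv_leftInverse (t : ℝ) (v u : ℝ × ℝ) :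
    h.flowDeriv (-t) (h.planeFlow t v) (h.flowDeriv t v u) = u := by
  have h1 := (h.hasFDerivAt_planeFlow (-t) (h.planeFlow t v)).comp v (h.hasFDerivAt_planeFlow t v)
  have h2 : h.planeFlow (-t) ∘ h.planeFlow t = id := funext fun w => h.planeFlow_neg_self t w
  rw [h2] at h1
  have := h1.unique (hasFDerivAt_id v)
  exact congrArg (fun A : ℝ × ℝ →L[ℝ] ℝ × ℝ => A u) this

lemma flowDeriv_vf (t : ℝ) (v : ℝ × ℝ) : h.flowDeriv t v (h.vf v) = h.vf (h.planeFlow t v) := by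
  have h1 := h.hasDerivAt_planeFlow 0 v
  rw [h.planeFlow_zero] at h1
  have h2 : HasDerivAt (fun s => h.planeFlow t (h.planeFlow s v)) (h.flowDeriv t v (h.vf v)) 0 := by
    have h0 : HasFDerivAt (h.planeFlow t) (h.flowDeriv t v) (h.planeFlow 0 v) := by
      rw [h.planeFlow_zero]; exact h.hasFDerivAt_planeFlow t v
    exact h0.comp_hasDerivAt (0 : ℝ) h1
  have h3 := h.hasDerivAt_planeFlow (0 + t) v
  have h4 := h3.comp_add_const 0 t
  rw [zero_add] at h4
  refine h2.unique (h4.congr_of_eventuallyEq (Filter.Eventually.of_forall fun s => ?_))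
  simp only [← h.planeFlow_add, add_comm]

lemma cross_flowDeriv_ne_zero (t : ℝ) (v : ℝ × ℝ) {u w : ℝ × ℝ} (huw : cross u w ≠ 0) :
    cross (h.flowDeriv t v u) (h.flowDeriv t v w) ≠ 0 :=
  cross_map_ne_zero (h.flowDeriv_leftInverse t v) huw

lemma planeFlow_ne_add_intVec (hper : h.NoPeriodicOrbits) {t : ℝ} (ht : 0 < t) (v : ℝ × ℝ)
    (k : ℤ × ℤ) : h.planeFlow t v ≠ v + intVec k := by
  intro he
  apply hper (projT2 v) t ht
  rw [← h.projT2_planeFlow, he, projT2_add_intVec]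

/-- A curve moving across the flow while being transported by it. -/
lemma hasDerivAt_planeFlow_comp {τ : ℝ → ℝ} {c : ℝ → ℝ × ℝ} {τ' : ℝ} {c' : ℝ × ℝ} {r : ℝ}
    (hτ : HasDerivAt τ τ' r) (hc : HasDerivAt c c' r) :
    HasDerivAt (fun r => h.planeFlow (τ r) (c r))
      (τ' • h.vf (h.planeFlow (τ r) (c r)) + h.flowDeriv (τ r) (c r) c') r := by
  have hF := (h.contDiff_planeFlow.differentiable one_ne_zero (τ r, c r)).hasFDerivAt
  have h1 := hF.comp_hasDerivAt r (hτ.prodMk hc)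
  have e1 : HasDerivAt (fun s : ℝ => (s, c r)) ((1 : ℝ), (0 : ℝ × ℝ)) (τ r) :=
    (hasDerivAt_id _).prodMk (hasDerivAt_const _ _)
  have h2' := hF.comp_hasDerivAt (τ r) e1
  have h2 := (h.hasDerivAt_planeFlow (τ r) (c r)).unique h2'
  have e2 : HasFDerivAt (fun w : ℝ × ℝ => (τ r, w)) (ContinuousLinearMap.inr ℝ ℝ (ℝ × ℝ)) (c r) :=
    hasFDerivAt_prodMk_right _ _
  have h3' := hF.comp (c r) e2
  have h3 := (h.hasFDerivAt_planeFlow (τ r) (c r)).unique h3'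
  have e3 : ((τ', c') : ℝ × (ℝ × ℝ)) = τ' • (1, 0) + (0, c') := by simp
  have key : fderiv ℝ (fun p : ℝ × (ℝ × ℝ) => h.planeFlow p.1 p.2) (τ r, c r) (τ', c') =
      τ' • h.vf (h.planeFlow (τ r) (c r)) + h.flowDeriv (τ r) (c r) c' := by
    rw [e3, map_add, map_smul, h2, h3]
    rfl
  rw [← key]
  exact h1

end C1FlowT2

/-- A `C¹` curve in the plane whose projection to the torus is closed, and which is transverse to
the vector field `X` over the parameter interval `[0, 1]`. -/
structure ClosedTransverseArc (X : ℝ × ℝ → ℝ × ℝ) where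
  curve : ℝ → ℝ × ℝ
  vel : ℝ → ℝ × ℝ
  per : ℤ × ℤ
  hasDerivAt : ∀ r, HasDerivAt curve (vel r) r
  continuous_vel : Continuous vel
  curve_one : curve 1 = curve 0 + intVec per
  cross_ne : ∀ r ∈ Icc (0 : ℝ) 1, cross (X (curve r)) (vel r) ≠ 0

namespace C1FlowT2

variable (h : C1FlowT2)

/-- Flowing a transverse segment which connects a point of an orbit to a translate of a later point
of this orbit, one gets a closed transverse arc through each point of the orbit. -/
lemma exists_arc_of_segment {q x y : ℝ × ℝ} {i b : ℝ} {k l : ℤ × ℤ}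
    (hx : x = h.planeFlow i q - intVec k) (hy : y = h.planeFlow b q - intVec l)
    (hseg : ∀ r ∈ Icc (0 : ℝ) 1, cross (h.vf (x + (1 - r) • (y - x))) (y - x) ≠ 0) :
    ∃ Γ : ClosedTransverseArc h.vf, Γ.curve 0 = q := by
  have hτ : ∀ r : ℝ, HasDerivAt (fun r : ℝ => (b - i) * r - b) (b - i) r := fun r => by
    simpa using ((hasDerivAt_id r).const_mul (b - i)).sub_const b
  have hc : ∀ r : ℝ, HasDerivAt (fun r : ℝ => x + (1 - r) • (y - x)) (-(y - x)) r := fun r => by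
    simpa using (((hasDerivAt_id r).const_sub 1).smul_const (y - x)).const_add x
  have hd := fun r => (h.hasDerivAt_planeFlow_comp (hτ r) (hc r)).add_const (intVec l)
  have h0 : h.planeFlow (-b) y + intVec l = q := by
    rw [hy, h.planeFlow_sub_intVec, h.planeFlow_neg_self, sub_add_cancel]
  refine ⟨⟨_, _, l - k, hd, ?_, ?_, ?_⟩, ?_⟩
  · have h1 : Continuous fun r : ℝ => ((b - i) * r - b, x + (1 - r) • (y - x)) := by fun_prop
    have h2 := h.continuous_planeFlow.comp h1
    have h3 : Continuous fun r : ℝ =>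
        h.flowDeriv ((b - i) * r - b) (x + (1 - r) • (y - x)) (-(y - x)) := by
      have hF := (h.contDiff_planeFlow.continuous_fderiv one_ne_zero).comp h1
      have hF2 : Continuous fun r : ℝ => (fderiv ℝ (fun p : ℝ × (ℝ × ℝ) => h.planeFlow p.1 p.2)
          ((b - i) * r - b, x + (1 - r) • (y - x))) (0, -(y - x)) :=
        hF.clm_apply continuous_const
      refine hF2.congr fun r => ?_
      have h4 := h.hasDerivAt_planeFlow_comp (τ := fun _ => (b - i) * r - b) (hasDerivAt_const r _)
        (hc r)
      have h5 := (h.contDiff_planeFlow.differentiable one_ne_zero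
        ((b - i) * r - b, x + (1 - r) • (y - x))).hasFDerivAt
      have h6 := h5.comp_hasDerivAt r
        ((hasDerivAt_const r ((b - i) * r - b)).prodMk (hc r))
      simpa using h6.unique h4
    exact ((h.continuous_vf.comp h2).const_smul (b - i)).add h3
  · have e1 : (b - i) * 1 - b = -i := by ring
    simp only [mul_zero, zero_sub, sub_zero, one_smul, add_sub_cancel, sub_self, zero_smul,
      add_zero, e1, h0, hx, h.planeFlow_sub_intVec, h.planeFlow_neg_self, intVec_sub]
    abel
  · intro r hr
    have := h.cross_flowDeriv_ne_zero ((b - i) * r - b) (x + (1 - r) • (y - x)) (hseg r hr)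
    rw [h.flowDeriv_vf] at this
    simp only [h.vf_add_intVec, map_neg]
    intro h0
    apply this
    simp only [cross, Prod.fst_add, Prod.snd_add, Prod.smul_fst, Prod.smul_snd, Prod.fst_neg,
      Prod.snd_neg, smul_eq_mul] at h0 ⊢
    linear_combination -h0
  · simp only [mul_zero, zero_sub, sub_zero, one_smul, add_sub_cancel]
    exact h0

/-- Two points close to `P` can be put in a position orthogonal to `X P` by a small time shift,
so that the segment which joins them is transverse. -/
lemma exists_nhds_transverse_segment (hcrit : h.NoCriticalPoints) (P : ℝ × ℝ) :
    ∃ V ∈ nhds P, ∀ x ∈ V, ∀ z ∈ V, ∃ τ : ℝ, |τ| < 1 ∧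
      (h.planeFlow τ z ≠ x → ∀ r ∈ Icc (0 : ℝ) 1,
        cross (h.vf (x + (1 - r) • (h.planeFlow τ z - x))) (h.planeFlow τ z - x) ≠ 0) := by
  set e := h.vf P with he
  have hepos : 0 < e.1 * e.1 + e.2 * e.2 := by
    rcases Prod.ext_iff.not.1 (hcrit P) |> not_and_or.1 with h1 | h1
    · exact add_pos_of_pos_of_nonneg (mul_self_pos.2 h1) (mul_self_nonneg _)
    · exact add_pos_of_nonneg_of_pos (mul_self_nonneg _) (mul_self_pos.2 h1)
  have hX : ∀ᶠ y in nhds P, 0 < (h.vf y).1 * e.1 + (h.vf y).2 * e.2 := by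
    have hc : Continuous fun y => (h.vf y).1 * e.1 + (h.vf y).2 * e.2 :=
      ((h.continuous_vf.fst).mul_const _).add ((h.continuous_vf.snd).mul_const _)
    exact hc.continuousAt.eventually (lt_mem_nhds hepos)
  obtain ⟨ρ, hρ, hball⟩ := Metric.eventually_nhds_iff_ball.1 hX
  have hφ : ∀ᶠ p : ℝ × (ℝ × ℝ) in nhds (0, P), h.planeFlow p.1 p.2 ∈ Metric.ball P ρ := by
    apply h.continuous_planeFlow.continuousAt.eventually
    change ∀ᶠ y in nhds (h.planeFlow 0 P), y ∈ Metric.ball P ρ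
    rw [h.planeFlow_zero]
    exact Metric.ball_mem_nhds P hρ
  obtain ⟨δ, hδ, hδball⟩ := Metric.eventually_nhds_iff_ball.1 hφ
  set τ₀ := min (δ / 2) (1 / 2) with hτ₀
  have hτpos : 0 < τ₀ := lt_min (by linarith) (by norm_num)
  have hτδ : τ₀ < δ := (min_le_left _ _).trans_lt (by linarith)
  have hτ1 : τ₀ < 1 := (min_le_right _ _).trans_lt (by norm_num)
  set g : ℝ → ℝ × ℝ → ℝ := fun τ z => (h.planeFlow τ z).1 * e.1 + (h.planeFlow τ z).2 * e.2 with hg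
  have hgder : ∀ τ z, HasDerivAt (fun τ => g τ z)
      ((h.vf (h.planeFlow τ z)).1 * e.1 + (h.vf (h.planeFlow τ z)).2 * e.2) τ := by
    intro τ z
    have := h.hasDerivAt_planeFlow τ z
    exact ((hasDerivAt_prod_fst this).mul_const _).add ((hasDerivAt_prod_snd this).mul_const _)
  have hmem : ∀ τ ∈ Icc (-τ₀) τ₀, ∀ z ∈ Metric.ball P δ, h.planeFlow τ z ∈ Metric.ball P ρ := by
    intro τ hτ z hz
    apply hδball (τ, z)
    rw [Metric.mem_ball, Prod.dist_eq, max_lt_iff]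
    refine ⟨?_, hz⟩
    rw [Real.dist_eq, sub_zero, abs_lt]
    exact ⟨by linarith [hτ.1], by linarith [hτ.2]⟩
  have hmono : StrictMonoOn (fun τ => g τ P) (Icc (-τ₀) τ₀) := by
    apply strictMonoOn_of_deriv_pos (convex_Icc _ _)
      (fun τ _ => (hgder τ P).continuousAt.continuousWithinAt)
    intro τ hτ
    rw [interior_Icc] at hτ
    rw [(hgder τ P).deriv]
    exact hball _ (hmem τ (Ioo_subset_Icc_self hτ) P (Metric.mem_ball_self hδ))
  have hP1 : g (-τ₀) P < P.1 * e.1 + P.2 * e.2 := by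
    have := hmono (a := -τ₀) (b := 0) ⟨le_rfl, by linarith⟩ ⟨by linarith, hτpos.le⟩ (by linarith)
    simpa [hg, h.planeFlow_zero] using this
  have hP2 : P.1 * e.1 + P.2 * e.2 < g τ₀ P := by
    have := hmono (a := 0) (b := τ₀) ⟨by linarith, hτpos.le⟩ ⟨by linarith, le_rfl⟩ hτpos
    simpa [hg, h.planeFlow_zero] using this
  obtain ⟨c₁, hc₁, hc₁'⟩ := exists_between hP1
  obtain ⟨c₂, hc₂, hc₂'⟩ := exists_between hP2
  have hgc : ∀ τ, Continuous (g τ) := by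
    intro τ
    have h1 : Continuous (h.planeFlow τ) :=
      h.continuous_planeFlow.comp (by fun_prop : Continuous fun v : ℝ × ℝ => (τ, v))
    exact (h1.fst.mul_const _).add (h1.snd.mul_const _)
  have hlc : Continuous fun y : ℝ × ℝ => y.1 * e.1 + y.2 * e.2 := by fun_prop
  have hV : ∀ᶠ y in nhds P, (y ∈ Metric.ball P (min ρ δ)) ∧ g (-τ₀) y < c₁ ∧ c₂ < g τ₀ y ∧
      c₁ < y.1 * e.1 + y.2 * e.2 ∧ y.1 * e.1 + y.2 * e.2 < c₂ := by
    refine Filter.Eventually.and (Metric.ball_mem_nhds P (lt_min hρ hδ)) ?_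
    refine ((hgc _).continuousAt.eventually (gt_mem_nhds hc₁)).and ?_
    refine ((hgc _).continuousAt.eventually (lt_mem_nhds hc₂')).and ?_
    exact (hlc.continuousAt.eventually (lt_mem_nhds hc₁')).and
      (hlc.continuousAt.eventually (gt_mem_nhds hc₂))
  refine ⟨_, hV, ?_⟩
  rintro x ⟨hxb, -, -, hx1, hx2⟩ z ⟨hzb, hz1, hz2, -, -⟩
  have hcont : ContinuousOn (fun τ => g τ z) (Icc (-τ₀) τ₀) :=
    fun τ _ => (hgder τ z).continuousAt.continuousWithinAt
  obtain ⟨τ, hτ, hgτ⟩ : x.1 * e.1 + x.2 * e.2 ∈ (fun τ => g τ z) '' Icc (-τ₀) τ₀ :=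
    intermediate_value_Icc (by linarith) hcont ⟨by linarith, by linarith⟩
  refine ⟨τ, abs_lt.2 ⟨by linarith [hτ.1], by linarith [hτ.2]⟩, fun hne r hr => ?_⟩
  have hyb := hmem τ hτ z (Metric.ball_subset_ball (min_le_right _ _) hzb)
  have hxb' := Metric.ball_subset_ball (min_le_left _ _) hxb
  have hsegb : x + (1 - r) • (h.planeFlow τ z - x) ∈ Metric.ball P ρ :=
    (convex_ball P ρ).add_smul_sub_mem hxb' hyb ⟨by linarith [hr.2], by linarith [hr.1]⟩
  have hpos := hball _ hsegb
  simp only [hg] at hgτ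
  have hperp : (h.planeFlow τ z - x).1 * e.1 + (h.planeFlow τ z - x).2 * e.2 = 0 := by
    simp only [Prod.fst_sub, Prod.snd_sub]
    linarith
  have hne' : h.planeFlow τ z - x ≠ 0 := sub_ne_zero.2 hne
  generalize h.planeFlow τ z - x = d at hpos hperp hne' ⊢
  generalize h.vf (x + (1 - r) • d) = u at hpos ⊢
  intro hcr
  simp only [cross] at hcr
  apply hne'
  have h1 : d.1 * (u.1 * e.1 + u.2 * e.2) = 0 := by linear_combination u.1 * hperp - e.2 * hcr
  have h2 : d.2 * (u.1 * e.1 + u.2 * e.2) = 0 := by linear_combination u.2 * hperp + e.1 * hcr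
  exact Prod.ext ((mul_eq_zero.1 h1).resolve_right hpos.ne')
    ((mul_eq_zero.1 h2).resolve_right hpos.ne')

/-- Through every point of the plane passes a closed transverse arc. -/
lemma exists_arc_through (hcrit : h.NoCriticalPoints) (hper : h.NoPeriodicOrbits) (q : ℝ × ℝ) :
    ∃ Γ : ClosedTransverseArc h.vf, Γ.curve 0 = q := by
  set k : ℕ → ℤ × ℤ := fun j => (⌊(h.planeFlow j q).1⌋, ⌊(h.planeFlow j q).2⌋) with hk
  have hmem : ∀ j : ℕ, h.planeFlow j q - intVec (k j) ∈ Icc (0 : ℝ) 1 ×ˢ Icc (0 : ℝ) 1 := by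
    intro j
    exact ⟨⟨Int.fract_nonneg _, (Int.fract_lt_one _).le⟩,
      ⟨Int.fract_nonneg _, (Int.fract_lt_one _).le⟩⟩
  obtain ⟨P, -, σ, hσ, hlim⟩ := (isCompact_Icc.prod isCompact_Icc).tendsto_subseq hmem
  obtain ⟨V, hV, hVseg⟩ := h.exists_nhds_transverse_segment hcrit P
  obtain ⟨N, hN⟩ := Filter.eventually_atTop.1 (hlim.eventually hV)
  set i := σ N
  set j := σ (N + 1)
  have hij : i < j := hσ (Nat.lt_succ_self N)
  obtain ⟨τ, hτ, hseg⟩ := hVseg _ (hN N le_rfl) _ (hN (N + 1) (Nat.le_succ N))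
  have hy : h.planeFlow τ (h.planeFlow j q - intVec (k j)) =
      h.planeFlow (τ + j) q - intVec (k j) := by
    rw [h.planeFlow_sub_intVec, h.planeFlow_add]
  refine h.exists_arc_of_segment (i := i) (b := τ + j) (k := k i) (l := k j) rfl hy (hseg ?_)
  intro he
  change h.planeFlow τ (h.planeFlow j q - intVec (k j)) = h.planeFlow i q - intVec (k i) at he
  rw [hy] at he
  have hpos : 0 < τ + j - i := by
    have : (i : ℝ) + 1 ≤ j := by exact_mod_cast hij
    linarith [(abs_lt.1 hτ).1]
  apply h.planeFlow_ne_add_intVec hper hpos (h.planeFlow i q) (k j - k i)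
  rw [← h.planeFlow_add, sub_add_cancel, intVec_sub]
  rw [sub_eq_iff_eq_add] at he
  rw [he]
  abel

end C1FlowT2

/-- A `C¹` bump function on the circle `ℝ / ℤ`, of integral `1` and supported in the
`ε`-neighborhood of `0`, together with a primitive. -/
structure PeriodicBump (ε : ℝ) where
  k : ℝ → ℝ
  k' : ℝ → ℝ
  B : ℝ → ℝ
  hasDerivAt_k : ∀ x, HasDerivAt k (k' x) x
  hasDerivAt_B : ∀ x, HasDerivAt B (k x) x
  continuous_k' : Continuous k'
  k_add_int : ∀ x (m : ℤ), k (x + m) = k x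
  B_add_int : ∀ x (m : ℤ), B (x + m) = B x + m
  nonneg : ∀ x, 0 ≤ k x
  pos_zero : 0 < k 0
  supp : ∀ x, k x ≠ 0 → ∃ m : ℤ, |x - m| < ε

lemma exists_periodicBump {ε : ℝ} (hε : 0 < ε) (hε' : ε ≤ 1 / 2) : Nonempty (PeriodicBump ε) := by
  have hπ := Real.pi_pos
  set g : ℝ → ℝ := fun x => Real.smoothTransition (Real.cos (2 * Real.pi * x) -
    Real.cos (2 * Real.pi * ε)) with hg
  have hgC : ContDiff ℝ 1 g := Real.smoothTransition.contDiff.comp (by fun_prop)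
  have hgper : Function.Periodic g 1 := by
    intro x
    simp only [hg]
    rw [mul_add, mul_one, Real.cos_add_two_pi]
  have hg0 : 0 < g 0 := by
    apply Real.smoothTransition.pos_of_pos
    have : Real.cos (2 * Real.pi * ε) < Real.cos 0 :=
      Real.strictAntiOn_cos ⟨le_rfl, hπ.le⟩ ⟨by positivity, by nlinarith⟩ (by positivity)
    simpa using this
  have hgnn : ∀ x, 0 ≤ g x := fun x => Real.smoothTransition.nonneg _
  have hgint : ∀ a b, IntervalIntegrable g volume a b := fun a b =>
    hgC.continuous.intervalIntegrable a b
  set Z := ∫ x in (0 : ℝ)..1, g x with hZ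
  have hZpos : 0 < Z := intervalIntegral.integral_pos one_pos hgC.continuous.continuousOn
    (fun x _ => hgnn x) ⟨0, ⟨le_rfl, zero_le_one⟩, hg0⟩
  have hshift : ∀ x (m : ℤ), g (x + m) = g x := fun x m => by
    simpa using hgper.int_mul m x
  refine ⟨⟨fun x => Z⁻¹ * g x, fun x => Z⁻¹ * deriv g x, fun x => Z⁻¹ * ∫ y in (0 : ℝ)..x, g y,
    fun x => ((hgC.differentiable one_ne_zero x).hasDerivAt).const_mul _,
    fun x => (intervalIntegral.integral_hasDerivAt_right (hgint 0 x)
      (hgC.continuous.stronglyMeasurableAtFilter _ _) hgC.continuous.continuousAt).const_mul _,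
    continuous_const.mul (hgC.continuous_deriv le_rfl), fun x m => by simp only [hshift], ?_,
    fun x => mul_nonneg (inv_nonneg.2 hZpos.le) (hgnn x), mul_pos (inv_pos.2 hZpos) hg0, ?_⟩⟩
  · intro x m
    have h1 := hgper.intervalIntegral_add_zsmul_eq m x hgint
    have h2 := hgper.intervalIntegral_add_eq x 0
    simp only [zsmul_eq_mul, mul_one, zero_add] at h1 h2
    have h3 := intervalIntegral.integral_add_adjacent_intervals (hgint 0 x) (hgint x (x + m))
    rw [← h3, h1, h2, ← hZ]
    field_simp
  · intro x hx
    have hgx : g x ≠ 0 := right_ne_zero_of_mul hx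
    have hpos : 0 < Real.cos (2 * Real.pi * x) - Real.cos (2 * Real.pi * ε) := by
      by_contra hle
      exact hgx (Real.smoothTransition.zero_of_nonpos (not_lt.1 hle))
    refine ⟨round x, ?_⟩
    have h1 : |x - round x| ≤ 1 / 2 := abs_sub_round x
    have h2 : Real.cos (2 * Real.pi * x) = Real.cos (2 * Real.pi * |x - round x|) := by
      rw [← abs_of_pos (by positivity : 0 < 2 * Real.pi), ← abs_mul, Real.cos_abs,
        abs_of_pos (by positivity : 0 < 2 * Real.pi), mul_sub, mul_comm _ (round x : ℝ),
        Real.cos_sub_int_mul_two_pi]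
    rw [h2] at hpos
    by_contra hle
    have h3 : Real.cos (2 * Real.pi * |x - round x|) ≤ Real.cos (2 * Real.pi * ε) :=
      Real.strictAntiOn_cos.antitoneOn ⟨by positivity, by nlinarith⟩
        ⟨by positivity, by nlinarith⟩ (by nlinarith)
    linarith

namespace PeriodicBump

variable {ε : ℝ} (β : PeriodicBump ε)

lemma continuous_k : Continuous β.k :=
  continuous_iff_continuousAt.2 fun x => (β.hasDerivAt_k x).continuousAt

lemma continuous_B : Continuous β.B :=
  continuous_iff_continuousAt.2 fun x => (β.hasDerivAt_B x).continuousAt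

lemma k_periodic : Function.Periodic β.k 1 := fun x => by simpa using β.k_add_int x 1

lemma exists_bound : ∃ M, 0 ≤ M ∧ ∀ x, |β.k x| ≤ M := by
  obtain ⟨M, hM⟩ := (β.k_periodic.compact_of_continuous one_ne_zero β.continuous_k).isBounded
    |>.exists_norm_le
  exact ⟨M, (norm_nonneg _).trans (hM _ ⟨0, rfl⟩), fun x => hM _ ⟨x, rfl⟩⟩

lemma exists_lipschitz : ∃ L, 0 ≤ L ∧ ∀ x y, |β.k x - β.k y| ≤ L * |x - y| := by
  have hper : Function.Periodic β.k' 1 := fun x => by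
    have h1 := (β.hasDerivAt_k (x + 1)).comp_add_const x 1
    rw [show (fun x => β.k (x + 1)) = β.k from funext β.k_periodic] at h1
    exact h1.unique (β.hasDerivAt_k x)
  obtain ⟨L, hL⟩ := (hper.compact_of_continuous one_ne_zero β.continuous_k').isBounded
    |>.exists_norm_le
  refine ⟨L, (norm_nonneg _).trans (hL _ ⟨0, rfl⟩), fun x y => ?_⟩
  exact convex_univ.norm_image_sub_le_of_norm_hasDerivWithin_le
    (fun z _ => (β.hasDerivAt_k z).hasDerivWithinAt) (fun z _ => hL _ ⟨z, rfl⟩) (mem_univ y)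
    (mem_univ x)

end PeriodicBump

/-- Differentiation under the integral sign for continuously differentiable integrands. -/
lemma hasFDerivAt_intervalIntegral_of_continuous {E : Type*} [NormedAddCommGroup E]
    [NormedSpace ℝ E] [ProperSpace E] {f : E → ℝ → ℝ} {f' : E → ℝ → E →L[ℝ] ℝ}
    (hf : ∀ v r, HasFDerivAt (fun v => f v r) (f' v r) v) (hfc : ∀ v, Continuous (f v))
    (hf' : Continuous fun p : E × ℝ => f' p.1 p.2) (a b : ℝ) (v : E) :
    HasFDerivAt (fun v => ∫ r in a..b, f v r) (∫ r in a..b, f' v r) v := by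
  have hK : IsCompact (Metric.closedBall v 1 ×ˢ uIcc a b) :=
    (isCompact_closedBall v 1).prod isCompact_uIcc
  obtain ⟨C, hC⟩ := hK.exists_bound_of_continuousOn hf'.continuousOn
  refine intervalIntegral.hasFDerivAt_integral_of_dominated_of_fderiv_le (bound := fun _ => C)
    (Metric.closedBall_mem_nhds v one_pos) ?_ ((hfc v).intervalIntegrable _ _) ?_ ?_
    intervalIntegrable_const ?_
  · exact Filter.Eventually.of_forall fun w => (hfc w).aestronglyMeasurable
  · exact (hf'.comp (Continuous.prodMk_right v)).aestronglyMeasurable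
  · exact Filter.Eventually.of_forall fun r hr w hw => hC (w, r) ⟨hw, uIoc_subset_uIcc hr⟩
  · exact Filter.Eventually.of_forall fun r _ w _ => hf w r

/-- A function on the plane with Lipschitz partial derivatives `G₁`, `G₂`, equivariant with
respect to integer translations, and nondecreasing in the direction of the vector field `X`. -/
structure PeriodicForm (X : ℝ × ℝ → ℝ × ℝ) where
  fn : ℝ × ℝ → ℝ
  G₁ : ℝ × ℝ → ℝ
  G₂ : ℝ × ℝ → ℝ
  a : ℤ
  b : ℤ
  hasFDerivAt : ∀ v, HasFDerivAt fn
    (G₁ v • ContinuousLinearMap.fst ℝ ℝ ℝ + G₂ v • ContinuousLinearMap.snd ℝ ℝ ℝ) v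
  lipschitz₁ : ∃ K, LipschitzWith K G₁
  lipschitz₂ : ∃ K, LipschitzWith K G₂
  fn_add : ∀ v (m : ℤ × ℤ), fn (v + intVec m) = fn v + (a * m.1 + b * m.2)
  nonneg : ∀ v, 0 ≤ G₁ v * (X v).1 + G₂ v * (X v).2

namespace ClosedTransverseArc

variable {X : ℝ × ℝ → ℝ × ℝ} (Γ : ClosedTransverseArc X)

lemma continuous_curve : Continuous Γ.curve :=
  continuous_iff_continuousAt.2 fun r => (Γ.hasDerivAt r).continuousAt

/-- With a suitable sign, the arc is positively transverse to `X`, uniformly near the arc. -/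
lemma exists_sign (hX : Continuous X) : ∃ s : ℤ, ∃ δ > 0, ∀ r ∈ Icc (0 : ℝ) 1, ∀ v,
    dist v (Γ.curve r) < δ → 0 < s * cross (X v) (Γ.vel r) := by
  have hc : Continuous fun p : (ℝ × ℝ) × ℝ => cross (X p.1) (Γ.vel p.2) := by
    have h1 := hX.comp (continuous_fst : Continuous fun p : (ℝ × ℝ) × ℝ => p.1)
    have h2 := Γ.continuous_vel.comp (continuous_snd : Continuous fun p : (ℝ × ℝ) × ℝ => p.2)
    exact (h1.fst.mul h2.snd).sub (h1.snd.mul h2.fst)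
  have hγ : Continuous fun r => (Γ.curve r, r) := Γ.continuous_curve.prodMk continuous_id
  have hmem : (0 : ℝ) ∈ Icc (0 : ℝ) 1 := ⟨le_rfl, zero_le_one⟩
  obtain ⟨s, hs0⟩ : ∃ s : ℤ, 0 < s * cross (X (Γ.curve 0)) (Γ.vel 0) := by
    rcases lt_or_gt_of_ne (Γ.cross_ne 0 hmem) with h0 | h0
    · exact ⟨-1, by simpa using h0⟩
    · exact ⟨1, by simpa using h0⟩
  have hs : ∀ r ∈ Icc (0 : ℝ) 1, 0 < s * cross (X (Γ.curve r)) (Γ.vel r) := by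
    intro r hr
    have hpre : IsPreconnected ((fun r => s * cross (X (Γ.curve r)) (Γ.vel r)) '' Icc 0 1) :=
      isPreconnected_Icc.image _ (continuous_const.mul (hc.comp hγ)).continuousOn
    by_contra hle
    obtain ⟨r', hr', h0⟩ := hpre.Icc_subset ⟨r, hr, rfl⟩ ⟨0, hmem, rfl⟩ ⟨not_lt.1 hle, hs0.le⟩
    rcases mul_eq_zero.1 h0 with h1 | h1
    · rw [h1, zero_mul] at hs0
      exact lt_irrefl _ hs0
    · exact Γ.cross_ne r' hr' h1
  have hK : IsCompact ((fun r => (Γ.curve r, r)) '' Icc 0 1) := isCompact_Icc.image hγ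
  have hU : IsOpen {p : (ℝ × ℝ) × ℝ | 0 < s * cross (X p.1) (Γ.vel p.2)} :=
    isOpen_lt continuous_const (continuous_const.mul hc)
  obtain ⟨δ, hδ, hsub⟩ := hK.exists_thickening_subset_open hU (by
    rintro _ ⟨r, hr, rfl⟩
    exact hs r hr)
  refine ⟨s, δ, hδ, fun r hr v hv => ?_⟩
  apply hsub (a := (v, r))
  rw [Metric.mem_thickening_iff]
  exact ⟨_, ⟨r, hr, rfl⟩, by rw [Prod.dist_eq, dist_self, max_lt_iff]; exact ⟨hv, hδ⟩⟩

variable {ε : ℝ} (β : PeriodicBump ε)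

/-- A primitive of the `1`-form dual to the arc, regularized by a bump function. -/
def dualFn (v : ℝ × ℝ) : ℝ :=
  (∫ r in (0 : ℝ)..1, β.B (v.1 - (Γ.curve r).1) * β.k (v.2 - (Γ.curve r).2) * (Γ.vel r).2) -
    Γ.per.1 * β.B (v.2 - (Γ.curve 0).2)

/-- The weight of the point of parameter `r` in the regularized dual form at `v`. -/
def weight (v : ℝ × ℝ) (r : ℝ) : ℝ := β.k (v.1 - (Γ.curve r).1) * β.k (v.2 - (Γ.curve r).2)

lemma continuous_weight (v : ℝ × ℝ) : Continuous (Γ.weight β v) := by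
  have h1 := Γ.continuous_curve
  exact (β.continuous_k.comp (continuous_const.sub h1.fst)).mul
    (β.continuous_k.comp (continuous_const.sub h1.snd))

lemma hasDerivAt_comp_sub {f f' : ℝ → ℝ} (hf : ∀ x, HasDerivAt f (f' x) x) {g : ℝ → ℝ} {g' r : ℝ}
    (hg : HasDerivAt g g' r) (x : ℝ) :
    HasDerivAt (fun r => f (x - g r)) (-(f' (x - g r) * g')) r := by
  have := (hf (x - g r)).comp r (hg.const_sub x)
  rwa [mul_neg] at this

lemma integral_k_mul_vel (x : ℝ) :
    ∫ r in (0 : ℝ)..1, β.k (x - (Γ.curve r).2) * (Γ.vel r).2 = Γ.per.2 := by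
  have hd : ∀ r, HasDerivAt (fun r => -β.B (x - (Γ.curve r).2))
      (β.k (x - (Γ.curve r).2) * (Γ.vel r).2) r := fun r => by
    have h1 := hasDerivAt_comp_sub β.hasDerivAt_B (hasDerivAt_prod_snd (Γ.hasDerivAt r)) x
    simpa using h1.fun_neg
  rw [intervalIntegral.integral_eq_sub_of_hasDerivAt (fun r _ => hd r)]
  · rw [Γ.curve_one]
    have := β.B_add_int (x - (Γ.curve 0).2 - Γ.per.2) Γ.per.2
    rw [sub_add_cancel] at this
    simp only [Prod.snd_add, intVec, ← sub_sub]
    linarith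
  · exact ((β.continuous_k.comp (continuous_const.sub Γ.continuous_curve.snd)).mul
      Γ.continuous_vel.snd).intervalIntegrable _ _

lemma integral_B_mul_k' (v : ℝ × ℝ) :
    ∫ r in (0 : ℝ)..1, β.B (v.1 - (Γ.curve r).1) * (β.k' (v.2 - (Γ.curve r).2) * (Γ.vel r).2) =
      Γ.per.1 * β.k (v.2 - (Γ.curve 0).2) - ∫ r in (0 : ℝ)..1, Γ.weight β v r * (Γ.vel r).1 := by
  have hu : ∀ r, HasDerivAt (fun r => β.B (v.1 - (Γ.curve r).1))
      (-(β.k (v.1 - (Γ.curve r).1) * (Γ.vel r).1)) r := fun r =>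
    hasDerivAt_comp_sub β.hasDerivAt_B (hasDerivAt_prod_fst (Γ.hasDerivAt r)) v.1
  have hv : ∀ r, HasDerivAt (fun r => -β.k (v.2 - (Γ.curve r).2))
      (β.k' (v.2 - (Γ.curve r).2) * (Γ.vel r).2) r := fun r => by
    have h1 := hasDerivAt_comp_sub β.hasDerivAt_k (hasDerivAt_prod_snd (Γ.hasDerivAt r)) v.2
    simpa using h1.fun_neg
  have hc := Γ.continuous_curve
  rw [intervalIntegral.integral_mul_deriv_eq_deriv_mul (fun r _ => hu r) (fun r _ => hv r)]
  · have h1 := β.B_add_int (v.1 - (Γ.curve 0).1 - Γ.per.1) Γ.per.1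
    have h2 := β.k_add_int (v.2 - (Γ.curve 0).2 - Γ.per.2) Γ.per.2
    rw [sub_add_cancel] at h1 h2
    have h3 : (∫ r in (0 : ℝ)..1, -(β.k (v.1 - (Γ.curve r).1) * (Γ.vel r).1) *
        -β.k (v.2 - (Γ.curve r).2)) = ∫ r in (0 : ℝ)..1, Γ.weight β v r * (Γ.vel r).1 := by
      congr 1
      funext r
      simp only [weight]
      ring
    rw [h3, Γ.curve_one]
    simp only [Prod.fst_add, Prod.snd_add, intVec, ← sub_sub, ← h2]
    rw [h1]
    ring
  · exact ((β.continuous_k.comp (continuous_const.sub hc.fst)).mul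
      Γ.continuous_vel.fst).neg.intervalIntegrable _ _
  · exact ((β.continuous_k'.comp (continuous_const.sub hc.snd)).mul
      Γ.continuous_vel.snd).intervalIntegrable _ _

lemma hasFDerivAt_dualFn (v : ℝ × ℝ) : HasFDerivAt (Γ.dualFn β)
    ((∫ r in (0 : ℝ)..1, Γ.weight β v r * (Γ.vel r).2) • ContinuousLinearMap.fst ℝ ℝ ℝ +
      (-∫ r in (0 : ℝ)..1, Γ.weight β v r * (Γ.vel r).1) • ContinuousLinearMap.snd ℝ ℝ ℝ) v := by
  have hc := Γ.continuous_curve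
  have hvel := Γ.continuous_vel
  have h1 : ∀ (v : ℝ × ℝ) (c : ℝ),
      HasFDerivAt (fun v : ℝ × ℝ => v.1 - c) (ContinuousLinearMap.fst ℝ ℝ ℝ) v :=
    fun v c => hasFDerivAt_fst.sub_const c
  have h2 : ∀ (v : ℝ × ℝ) (c : ℝ),
      HasFDerivAt (fun v : ℝ × ℝ => v.2 - c) (ContinuousLinearMap.snd ℝ ℝ ℝ) v :=
    fun v c => hasFDerivAt_snd.sub_const c
  have hd : ∀ (v : ℝ × ℝ) (r : ℝ), HasFDerivAt
      (fun v : ℝ × ℝ => β.B (v.1 - (Γ.curve r).1) * β.k (v.2 - (Γ.curve r).2) * (Γ.vel r).2)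
      ((Γ.weight β v r * (Γ.vel r).2) • ContinuousLinearMap.fst ℝ ℝ ℝ +
        (β.B (v.1 - (Γ.curve r).1) * (β.k' (v.2 - (Γ.curve r).2) * (Γ.vel r).2)) •
          ContinuousLinearMap.snd ℝ ℝ ℝ) v := by
    intro v r
    have e1 := (β.hasDerivAt_B (v.1 - (Γ.curve r).1)).comp_hasFDerivAt v (h1 v (Γ.curve r).1)
    have e2 := (β.hasDerivAt_k (v.2 - (Γ.curve r).2)).comp_hasFDerivAt v (h2 v (Γ.curve r).2)
    refine ((e1.mul e2).mul_const _).congr_fderiv ?_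
    ext <;> simp [weight] <;> ring
  have hW : Continuous fun p : (ℝ × ℝ) × ℝ => Γ.weight β p.1 p.2 :=
    (β.continuous_k.comp (continuous_fst.fst.sub (hc.comp continuous_snd).fst)).mul
      (β.continuous_k.comp (continuous_fst.snd.sub (hc.comp continuous_snd).snd))
  have hV : Continuous fun p : (ℝ × ℝ) × ℝ => β.B (p.1.1 - (Γ.curve p.2).1) *
      (β.k' (p.1.2 - (Γ.curve p.2).2) * (Γ.vel p.2).2) :=
    (β.continuous_B.comp (continuous_fst.fst.sub (hc.comp continuous_snd).fst)).mul
      ((β.continuous_k'.comp (continuous_fst.snd.sub (hc.comp continuous_snd).snd)).mul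
        (hvel.comp continuous_snd).snd)
  have hW' : Continuous fun p : (ℝ × ℝ) × ℝ => Γ.weight β p.1 p.2 * (Γ.vel p.2).2 :=
    hW.mul (hvel.comp continuous_snd).snd
  have main := hasFDerivAt_intervalIntegral_of_continuous hd (fun v =>
    ((β.continuous_B.comp (continuous_const.sub hc.fst)).mul
      (β.continuous_k.comp (continuous_const.sub hc.snd))).mul hvel.snd)
    ((hW'.smul continuous_const).add (hV.smul continuous_const)) 0 1 v
  have e3 := ((β.hasDerivAt_B (v.2 - (Γ.curve 0).2)).comp_hasFDerivAt v
    (h2 v (Γ.curve 0).2)).const_mul (Γ.per.1 : ℝ)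
  refine (main.sub e3).congr_fderiv ?_
  have i1 : Continuous fun r => (Γ.weight β v r * (Γ.vel r).2) •
      ContinuousLinearMap.fst ℝ ℝ ℝ :=
    (hW'.comp (Continuous.prodMk_right v)).smul continuous_const
  have i2 : Continuous fun r => (β.B (v.1 - (Γ.curve r).1) *
      (β.k' (v.2 - (Γ.curve r).2) * (Γ.vel r).2)) • ContinuousLinearMap.snd ℝ ℝ ℝ :=
    (hV.comp (Continuous.prodMk_right v)).smul continuous_const
  rw [intervalIntegral.integral_add (i1.intervalIntegrable _ _) (i2.intervalIntegrable _ _),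
    intervalIntegral.integral_smul_const, intervalIntegral.integral_smul_const,
    Γ.integral_B_mul_k' β v]
  ext <;> simp

lemma dualFn_add (v : ℝ × ℝ) (m : ℤ × ℤ) :
    Γ.dualFn β (v + intVec m) = Γ.dualFn β v + (Γ.per.2 * m.1 + (-Γ.per.1 : ℤ) * m.2) := by
  have hc := Γ.continuous_curve
  have e : ∀ r, β.B ((v + intVec m).1 - (Γ.curve r).1) * β.k ((v + intVec m).2 - (Γ.curve r).2) *
      (Γ.vel r).2 = β.B (v.1 - (Γ.curve r).1) * β.k (v.2 - (Γ.curve r).2) * (Γ.vel r).2 +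
        m.1 * (β.k (v.2 - (Γ.curve r).2) * (Γ.vel r).2) := by
    intro r
    simp only [Prod.fst_add, Prod.snd_add, intVec, add_sub_right_comm, β.B_add_int, β.k_add_int]
    ring
  have hk : Continuous fun r => β.k (v.2 - (Γ.curve r).2) :=
    β.continuous_k.comp (continuous_const.sub hc.snd)
  simp only [dualFn]
  simp only [e]
  rw [intervalIntegral.integral_add, intervalIntegral.integral_const_mul, Γ.integral_k_mul_vel]
  · simp only [Prod.snd_add, intVec, add_sub_right_comm, β.B_add_int]
    push_cast
    ring
  · exact (((β.continuous_B.comp (continuous_const.sub hc.fst)).mul hk).mul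
      Γ.continuous_vel.snd).intervalIntegrable _ _
  · exact (continuous_const.mul (hk.mul Γ.continuous_vel.snd)).intervalIntegrable _ _

lemma exists_lipschitz_integral_weight {c : ℝ → ℝ} (hc : Continuous c) (s : ℝ) :
    ∃ K, LipschitzWith K fun v => s * ∫ r in (0 : ℝ)..1, Γ.weight β v r * c r := by
  obtain ⟨M, hM0, hM⟩ := β.exists_bound
  obtain ⟨L, hL0, hL⟩ := β.exists_lipschitz
  obtain ⟨C, hC⟩ := isCompact_Icc.exists_bound_of_continuousOn (s := Icc (0 : ℝ) 1) hc.continuousOn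
  have hC0 : 0 ≤ C := (norm_nonneg _).trans (hC 0 ⟨le_rfl, zero_le_one⟩)
  refine ⟨_, LipschitzWith.of_dist_le' (K := |s| * (2 * (M * L) * C)) fun v w => ?_⟩
  have hi : ∀ v, IntervalIntegrable (fun r => Γ.weight β v r * c r) volume 0 1 := fun v =>
    ((Γ.continuous_weight β v).mul hc).intervalIntegrable _ _
  rw [Real.dist_eq, ← mul_sub, abs_mul, ← intervalIntegral.integral_sub (hi v) (hi w), mul_assoc]
  refine mul_le_mul_of_nonneg_left ?_ (abs_nonneg s)
  have hb := intervalIntegral.norm_integral_le_of_norm_le_const (a := 0) (b := 1)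
    (f := fun r => Γ.weight β v r * c r - Γ.weight β w r * c r) (C := 2 * (M * L) * C * dist v w) ?_
  · simpa using hb
  intro r hr
  rw [uIoc_of_le zero_le_one] at hr
  rw [← sub_mul, norm_mul, mul_right_comm]
  refine mul_le_mul ?_ (hC r (Ioc_subset_Icc_self hr)) (norm_nonneg _) (by positivity)
  have d1 : |v.1 - w.1| ≤ dist v w := by
    rw [Prod.dist_eq, ← Real.dist_eq]
    exact le_max_left _ _
  have d2 : |v.2 - w.2| ≤ dist v w := by
    rw [Prod.dist_eq, ← Real.dist_eq]
    exact le_max_right _ _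
  have e1 := hL (v.1 - (Γ.curve r).1) (w.1 - (Γ.curve r).1)
  have e2 := hL (v.2 - (Γ.curve r).2) (w.2 - (Γ.curve r).2)
  rw [sub_sub_sub_cancel_right] at e1 e2
  simp only [weight]
  generalize v.1 - (Γ.curve r).1 = p at *
  generalize v.2 - (Γ.curve r).2 = q at *
  generalize w.1 - (Γ.curve r).1 = p' at *
  generalize w.2 - (Γ.curve r).2 = q' at *
  calc ‖β.k p * β.k q - β.k p' * β.k q'‖
      = |(β.k p - β.k p') * β.k q + β.k p' * (β.k q - β.k q')| := by
        rw [Real.norm_eq_abs]; congr 1; ring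
    _ ≤ |β.k p - β.k p'| * |β.k q| + |β.k p'| * |β.k q - β.k q'| := by
        rw [← abs_mul, ← abs_mul]; exact abs_add_le _ _
    _ ≤ (L * dist v w) * M + M * (L * dist v w) := by
        gcongr
        · exact e1.trans (by gcongr)
        · exact hM q
        · exact hM p'
        · exact e2.trans (by gcongr)
    _ = 2 * (M * L) * dist v w := by ring

end ClosedTransverseArc

namespace PeriodicForm

variable {X : ℝ × ℝ → ℝ × ℝ}

/-- The pairing of the differential of the function with the vector field `X`. -/
def pairing (θ : PeriodicForm X) (v : ℝ × ℝ) : ℝ := θ.G₁ v * (X v).1 + θ.G₂ v * (X v).2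

instance : Zero (PeriodicForm X) :=
  ⟨⟨fun _ => 0, fun _ => 0, fun _ => 0, 0, 0, fun v => by
    simpa using hasFDerivAt_const (0 : ℝ) v, ⟨0, LipschitzWith.const 0⟩, ⟨0, LipschitzWith.const 0⟩,
    fun _ _ => by simp, fun _ => by simp⟩⟩

instance : Add (PeriodicForm X) :=
  ⟨fun θ η => ⟨fun v => θ.fn v + η.fn v, fun v => θ.G₁ v + η.G₁ v, fun v => θ.G₂ v + η.G₂ v,
    θ.a + η.a, θ.b + η.b,
    fun v => ((θ.hasFDerivAt v).add (η.hasFDerivAt v)).congr_fderiv (by module),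
    ⟨_, θ.lipschitz₁.choose_spec.add η.lipschitz₁.choose_spec⟩,
    ⟨_, θ.lipschitz₂.choose_spec.add η.lipschitz₂.choose_spec⟩,
    fun v m => by rw [θ.fn_add, η.fn_add]; push_cast; ring,
    fun v => by linarith [θ.nonneg v, η.nonneg v]⟩⟩

lemma add_pairing (θ η : PeriodicForm X) (v : ℝ × ℝ) :
    (θ + η).pairing v = θ.pairing v + η.pairing v := by
  change (θ.G₁ v + η.G₁ v) * _ + (θ.G₂ v + η.G₂ v) * _ = _
  simp only [pairing]
  ring

variable (θ : PeriodicForm X)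

lemma continuous_G₁ : Continuous θ.G₁ := θ.lipschitz₁.choose_spec.continuous

lemma continuous_G₂ : Continuous θ.G₂ := θ.lipschitz₂.choose_spec.continuous

lemma continuous_fn : Continuous θ.fn :=
  continuous_iff_continuousAt.2 fun v => (θ.hasFDerivAt v).continuousAt

lemma continuous_pairing (hX : Continuous X) : Continuous θ.pairing :=
  (θ.continuous_G₁.mul hX.fst).add (θ.continuous_G₂.mul hX.snd)

lemma differential_add_intVec (v : ℝ × ℝ) (m : ℤ × ℤ) :
    θ.G₁ (v + intVec m) = θ.G₁ v ∧ θ.G₂ (v + intVec m) = θ.G₂ v := by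
  have h1 := (hasFDerivAt_comp_add_right (intVec m)).2 (θ.hasFDerivAt (v + intVec m))
  simp only [θ.fn_add] at h1
  have h2 := h1.unique ((θ.hasFDerivAt v).add_const _)
  constructor
  · simpa using congrArg (fun A : ℝ × ℝ →L[ℝ] ℝ => A (1, 0)) h2
  · simpa using congrArg (fun A : ℝ × ℝ →L[ℝ] ℝ => A (0, 1)) h2

lemma pairing_add_intVec (hXper : ∀ v k, X (v + intVec k) = X v) (v : ℝ × ℝ) (m : ℤ × ℤ) :
    θ.pairing (v + intVec m) = θ.pairing v := by
  simp only [pairing, hXper, (θ.differential_add_intVec v m).1, (θ.differential_add_intVec v m).2]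

end PeriodicForm

lemma exists_intVec_mem_square (v : ℝ × ℝ) :
    ∃ w ∈ Icc (0 : ℝ) 1 ×ˢ Icc (0 : ℝ) 1, ∃ m : ℤ × ℤ, v = w + intVec m := by
  refine ⟨(Int.fract v.1, Int.fract v.2), ⟨⟨Int.fract_nonneg _, (Int.fract_lt_one _).le⟩,
    ⟨Int.fract_nonneg _, (Int.fract_lt_one _).le⟩⟩, (⌊v.1⌋, ⌊v.2⌋), ?_⟩
  exact Prod.ext (Int.fract_add_floor _).symm (Int.fract_add_floor _).symm

namespace ClosedTransverseArc

variable {X : ℝ × ℝ → ℝ × ℝ} (Γ : ClosedTransverseArc X)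

/-- Each closed transverse arc gives a periodic form which is positive on `X` at the origin
of the arc. -/
lemma exists_form (hX : Continuous X) (hXper : ∀ v k, X (v + intVec k) = X v) :
    ∃ θ : PeriodicForm X, 0 < θ.pairing (Γ.curve 0) := by
  obtain ⟨s, δ, hδ, hs⟩ := Γ.exists_sign hX
  obtain ⟨β⟩ := exists_periodicBump (ε := min δ (1 / 2)) (lt_min hδ (by norm_num))
    (min_le_right _ _)
  have hpos : ∀ v, ∀ r ∈ Icc (0 : ℝ) 1, Γ.weight β v r ≠ 0 →
      0 < s * cross (X v) (Γ.vel r) := by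
    intro v r hr hw
    obtain ⟨m₁, hm₁⟩ := β.supp _ (left_ne_zero_of_mul hw)
    obtain ⟨m₂, hm₂⟩ := β.supp _ (right_ne_zero_of_mul hw)
    have e : v = v - intVec (m₁, m₂) + intVec (m₁, m₂) := (sub_add_cancel _ _).symm
    rw [e, hXper]
    refine hs r hr _ ?_
    rw [Prod.dist_eq, max_lt_iff, Real.dist_eq, Real.dist_eq]
    simp only [Prod.fst_sub, Prod.snd_sub, intVec, sub_right_comm _ (_ : ℝ) (Γ.curve r).1,
      sub_right_comm _ (_ : ℝ) (Γ.curve r).2]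
    exact ⟨hm₁.trans_le (min_le_left _ _), hm₂.trans_le (min_le_left _ _)⟩
  have hwnn : ∀ v r, 0 ≤ Γ.weight β v r := fun v r => mul_nonneg (β.nonneg _) (β.nonneg _)
  have hnn : ∀ v, ∀ r ∈ Icc (0 : ℝ) 1, 0 ≤ Γ.weight β v r * (s * cross (X v) (Γ.vel r)) := by
    intro v r hr
    by_cases hw : Γ.weight β v r = 0
    · rw [hw, zero_mul]
    · exact mul_nonneg (hwnn v r) (hpos v r hr hw).le
  have hweight : ∀ v, (s * ∫ r in (0 : ℝ)..1, Γ.weight β v r * (Γ.vel r).2) * (X v).1 +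
      (-s * ∫ r in (0 : ℝ)..1, Γ.weight β v r * (Γ.vel r).1) * (X v).2 =
        ∫ r in (0 : ℝ)..1, Γ.weight β v r * (s * cross (X v) (Γ.vel r)) := by
    intro v
    have hw := Γ.continuous_weight β v
    have c1 : IntervalIntegrable (fun r => (s * (X v).1) * (Γ.weight β v r * (Γ.vel r).2))
        volume 0 1 :=
      (continuous_const.mul (hw.mul Γ.continuous_vel.snd)).intervalIntegrable _ _
    have c2 : IntervalIntegrable (fun r => (s * (X v).2) * (Γ.weight β v r * (Γ.vel r).1))
        volume 0 1 :=
      (continuous_const.mul (hw.mul Γ.continuous_vel.fst)).intervalIntegrable _ _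
    have := intervalIntegral.integral_sub c1 c2
    rw [intervalIntegral.integral_const_mul, intervalIntegral.integral_const_mul] at this
    calc _ = s * (X v).1 * (∫ r in (0 : ℝ)..1, Γ.weight β v r * (Γ.vel r).2) -
          s * (X v).2 * ∫ r in (0 : ℝ)..1, Γ.weight β v r * (Γ.vel r).1 := by ring
      _ = _ := by
        rw [← this]
        congr 1
        funext r
        simp only [cross]
        ring
  refine ⟨⟨fun v => s * Γ.dualFn β v, fun v => s * ∫ r in (0 : ℝ)..1, Γ.weight β v r * (Γ.vel r).2,
    fun v => -s * ∫ r in (0 : ℝ)..1, Γ.weight β v r * (Γ.vel r).1, s * Γ.per.2, s * -Γ.per.1, ?_,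
    Γ.exists_lipschitz_integral_weight β Γ.continuous_vel.snd _,
    Γ.exists_lipschitz_integral_weight β Γ.continuous_vel.fst _, ?_, fun v => ?_⟩, ?_⟩
  · intro v
    exact ((Γ.hasFDerivAt_dualFn β v).const_mul (s : ℝ)).congr_fderiv (by module)
  · intro v m
    rw [Γ.dualFn_add]
    push_cast
    ring
  · rw [hweight v]
    exact intervalIntegral.integral_nonneg zero_le_one (hnn v)
  · simp only [PeriodicForm.pairing]
    rw [hweight]
    have hmem : (0 : ℝ) ∈ Icc (0 : ℝ) 1 := ⟨le_rfl, zero_le_one⟩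
    refine intervalIntegral.integral_pos one_pos ?_
      (fun r hr => hnn _ r (Ioc_subset_Icc_self hr)) ⟨0, hmem, ?_⟩
    · exact ((Γ.continuous_weight β _).mul (continuous_const.mul ((continuous_const.mul
        Γ.continuous_vel.snd).sub (continuous_const.mul Γ.continuous_vel.fst)))).continuousOn
    · have hw : 0 < Γ.weight β (Γ.curve 0) 0 := by
        simp only [weight, sub_self]
        exact mul_pos β.pos_zero β.pos_zero
      exact mul_pos hw (hpos _ 0 hmem hw.ne')

end ClosedTransverseArc

/-- If a closed transverse arc passes through every point, some periodic form is everywhere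
positive on `X`. -/
lemma exists_positive_form {X : ℝ × ℝ → ℝ × ℝ} (hX : Continuous X)
    (hXper : ∀ v k, X (v + intVec k) = X v)
    (harc : ∀ q, ∃ Γ : ClosedTransverseArc X, Γ.curve 0 = q) :
    ∃ θ : PeriodicForm X, ∀ v, 0 < θ.pairing v := by
  have hK : IsCompact (Icc (0 : ℝ) 1 ×ˢ Icc (0 : ℝ) 1) := isCompact_Icc.prod isCompact_Icc
  obtain ⟨θ, hθ⟩ : ∃ θ : PeriodicForm X, ∀ v ∈ Icc (0 : ℝ) 1 ×ˢ Icc (0 : ℝ) 1,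
      0 < θ.pairing v := by
    refine hK.induction_on (p := fun S => ∃ θ : PeriodicForm X, ∀ v ∈ S, 0 < θ.pairing v)
      ⟨0, fun v hv => hv.elim⟩ (fun S T hST ⟨θ, hθ⟩ => ⟨θ, fun v hv => hθ v (hST hv)⟩) ?_ ?_
    · rintro S T ⟨θ, hθ⟩ ⟨η, hη⟩
      refine ⟨θ + η, ?_⟩
      rintro v (hv | hv) <;> rw [PeriodicForm.add_pairing]
      · exact add_pos_of_pos_of_nonneg (hθ v hv) (η.nonneg v)
      · exact add_pos_of_nonneg_of_pos (θ.nonneg v) (hη v hv)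
    · intro q _
      obtain ⟨Γ, rfl⟩ := harc q
      obtain ⟨θ, hθ⟩ := Γ.exists_form hX hXper
      exact ⟨_, mem_nhdsWithin_of_mem_nhds
        ((θ.continuous_pairing hX).continuousAt.eventually (lt_mem_nhds hθ)), θ, fun v hv => hv⟩
  refine ⟨θ, fun v => ?_⟩
  obtain ⟨w, hw, m, rfl⟩ := exists_intVec_mem_square v
  rw [θ.pairing_add_intVec hXper]
  exact hθ w hw

/-- A bounded Lipschitz vector field has global integral curves. -/
lemma exists_global_integralCurve {E : Type*} [NormedAddCommGroup E] [NormedSpace ℝ E]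
    [CompleteSpace E] {Y : E → E} {K L : NNReal} (hY : LipschitzWith K Y) (hL : ∀ v, ‖Y v‖ ≤ L)
    (y : E) : ∃ z : ℝ → E, z 0 = y ∧ ∀ s, HasDerivAt z (Y (z s)) s := by
  have hloc : ∀ T : NNReal, ∃ z : ℝ → E, z 0 = y ∧
      ∀ s ∈ Ioo (-T : ℝ) T, HasDerivAt z (Y (z s)) s := by
    intro T
    have h0 : (0 : ℝ) ∈ Icc (-T : ℝ) T := ⟨by simp, T.2⟩
    have hpl : IsPicardLindelof (fun _ => Y) (⟨0, h0⟩ : Icc (-T : ℝ) T) y (L * T) 0 L K :=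
      ⟨fun _ _ => hY.lipschitzOnWith, fun _ _ => continuousOn_const, fun _ _ v _ => hL v,
        by simp⟩
    obtain ⟨z, hz0, hz⟩ := hpl.exists_eq_forall_mem_Icc_hasDerivWithinAt₀
    exact ⟨z, hz0, fun s hs => (hz s (Ioo_subset_Icc_self hs)).hasDerivAt (Icc_mem_nhds hs.1 hs.2)⟩
  choose z hz0 hz using hloc
  have huniq : ∀ S T : NNReal, S ≤ T → EqOn (z T) (z S) (Ioo (-S : ℝ) S) := by
    intro S T hST s hs
    have hsub : Ioo (-S : ℝ) S ⊆ Ioo (-T : ℝ) T :=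
      Ioo_subset_Ioo (neg_le_neg (NNReal.coe_le_coe.2 hST)) (NNReal.coe_le_coe.2 hST)
    have hpos : (0 : ℝ) < S := by linarith [hs.1, hs.2]
    exact ODE_solution_unique_of_mem_Ioo (v := fun _ => Y) (s := fun _ => univ) (t₀ := 0)
      (fun _ _ => hY.lipschitzOnWith) ⟨by linarith, hpos⟩
      (fun t ht => ⟨hz T t (hsub ht), mem_univ _⟩) (fun t ht => ⟨hz S t ht, mem_univ _⟩)
      (by rw [hz0, hz0]) hs
  refine ⟨fun s => z (Real.nnabs s + 1) s, hz0 _, fun s => ?_⟩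
  have habs : |s| < (Real.nnabs s + 1 : NNReal) := by simp
  refine (hz _ s (abs_lt.1 habs)).congr_of_eventuallyEq ?_
  filter_upwards [Ioo_mem_nhds (abs_lt.1 habs).1 (abs_lt.1 habs).2] with t ht
  rcases le_total (Real.nnabs s + 1) (Real.nnabs t + 1) with hle | hle
  · exact huniq _ _ hle ht
  · have ht' : |t| < (Real.nnabs t + 1 : NNReal) := by simp
    exact (huniq _ _ hle (abs_lt.1 ht')).symm

/-- Integral curves of a Lipschitz vector field are determined by one value. -/
lemma integralCurve_unique {E : Type*} [NormedAddCommGroup E] [NormedSpace ℝ E] {Y : E → E}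
    {K : NNReal} (hY : LipschitzWith K Y) {z w : ℝ → E} (hz : ∀ s, HasDerivAt z (Y (z s)) s)
    (hw : ∀ s, HasDerivAt w (Y (w s)) s) {s₀ : ℝ} (h₀ : z s₀ = w s₀) : z = w :=
  ODE_solution_unique_univ (v := fun _ => Y) (s := fun _ => univ) (fun _ => hY.lipschitzOnWith)
    (fun s => ⟨hz s, mem_univ _⟩) (fun s => ⟨hw s, mem_univ _⟩) h₀

namespace C1FlowT2

variable (h : C1FlowT2)

/-- The differential of the map obtained by flowing a transverse curve is invertible. -/
lemma exists_equiv_hasFDerivAt {z : ℝ → ℝ × ℝ} (hz : ContDiff ℝ 1 z)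
    (hcross : ∀ s, cross (deriv z s) (h.vf (z s)) ≠ 0) (p : ℝ × ℝ) :
    ∃ A : (ℝ × ℝ) ≃L[ℝ] (ℝ × ℝ),
      HasFDerivAt (fun p : ℝ × ℝ => h.planeFlow p.2 (z p.1)) (A : (ℝ × ℝ) →L[ℝ] (ℝ × ℝ)) p := by
  have hC : ContDiff ℝ 1 fun p : ℝ × ℝ => h.planeFlow p.2 (z p.1) :=
    h.contDiff_planeFlow.comp (contDiff_snd.prodMk (hz.comp contDiff_fst))
  have hA := (hC.differentiable one_ne_zero p).hasFDerivAt
  set A := fderiv ℝ (fun p : ℝ × ℝ => h.planeFlow p.2 (z p.1)) p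
  have hval : ∀ w : ℝ × ℝ, A w = w.2 • h.vf (h.planeFlow p.2 (z p.1)) +
      h.flowDeriv p.2 (z p.1) (w.1 • deriv z p.1) := by
    intro w
    have e1 : HasDerivAt (fun r : ℝ => p.1 + r * w.1) w.1 0 := by
      simpa using ((hasDerivAt_id (0 : ℝ)).mul_const w.1).const_add p.1
    have e2 : HasDerivAt (fun r : ℝ => p.2 + r * w.2) w.2 0 := by
      simpa using ((hasDerivAt_id (0 : ℝ)).mul_const w.2).const_add p.2
    have e3 : HasDerivAt z (deriv z p.1) (p.1 + 0 * w.1) := by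
      rw [zero_mul, add_zero]
      exact (hz.differentiable one_ne_zero p.1).hasDerivAt
    have e4 := h.hasDerivAt_planeFlow_comp e2 (e3.scomp 0 e1)
    simp only [Function.comp_apply, zero_mul, add_zero] at e4
    have e5 : HasDerivAt (fun r : ℝ => h.planeFlow (p.2 + r * w.2) (z (p.1 + r * w.1)))
        (A (w.1, w.2)) 0 :=
      hA.comp_hasDerivAt_of_eq (0 : ℝ) (e1.prodMk e2) (by simp)
    exact e5.unique e4
  have hinj : Function.Injective A := by
    refine (injective_iff_map_eq_zero A).2 fun w hw => ?_
    rw [hval, ← h.flowDeriv_vf, map_smul] at hw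
    have hne := h.cross_flowDeriv_ne_zero p.2 (z p.1) (hcross p.1)
    generalize h.flowDeriv p.2 (z p.1) (deriv z p.1) = u at *
    generalize h.flowDeriv p.2 (z p.1) (h.vf (z p.1)) = x at *
    have h1 := congrArg Prod.fst hw
    have h2 := congrArg Prod.snd hw
    simp only [Prod.fst_add, Prod.snd_add, Prod.smul_fst, Prod.smul_snd, smul_eq_mul, Prod.fst_zero,
      Prod.snd_zero, cross] at h1 h2 hne
    have k1 : w.1 * (u.1 * x.2 - u.2 * x.1) = 0 := by linear_combination x.2 * h1 - x.1 * h2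
    have k2 : w.2 * (u.1 * x.2 - u.2 * x.1) = 0 := by linear_combination u.1 * h2 - u.2 * h1
    exact Prod.ext ((mul_eq_zero.1 k1).resolve_right hne) ((mul_eq_zero.1 k2).resolve_right hne)
  refine ⟨(LinearEquiv.ofInjectiveEndo (A : (ℝ × ℝ) →ₗ[ℝ] (ℝ × ℝ)) hinj).toContinuousLinearEquiv,
    hA.congr_fderiv ?_⟩
  ext <;> rfl

/-- Flowing a transverse curve gives an open map. -/
lemma isOpenMap_flow_curve {z : ℝ → ℝ × ℝ} (hz : ContDiff ℝ 1 z)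
    (hcross : ∀ s, cross (deriv z s) (h.vf (z s)) ≠ 0) :
    IsOpenMap fun p : ℝ × ℝ => h.planeFlow p.2 (z p.1) := by
  have hC : ContDiff ℝ 1 fun p : ℝ × ℝ => h.planeFlow p.2 (z p.1) :=
    h.contDiff_planeFlow.comp (contDiff_snd.prodMk (hz.comp contDiff_fst))
  refine IsOpenMap.of_nhds_le fun p => ?_
  obtain ⟨A, hA⟩ := h.exists_equiv_hasFDerivAt hz hcross p
  exact (hC.contDiffAt.hasStrictFDerivAt' hA one_ne_zero).map_nhds_eq_of_equiv.ge

variable {h} {θ : PeriodicForm h.vf}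

lemma exists_pairing_lower_bound (hθ : ∀ v, 0 < θ.pairing v) : ∃ c > 0, ∀ v, c ≤ θ.pairing v := by
  have hK : IsCompact (Icc (0 : ℝ) 1 ×ˢ Icc (0 : ℝ) 1) := isCompact_Icc.prod isCompact_Icc
  obtain ⟨w, -, hmin⟩ := hK.exists_isMinOn ⟨(0, 0), by simp⟩
    (θ.continuous_pairing h.continuous_vf).continuousOn
  refine ⟨θ.pairing w, hθ w, fun v => ?_⟩
  obtain ⟨y, hy, m, rfl⟩ := exists_intVec_mem_square v
  rw [θ.pairing_add_intVec h.vf_add_intVec]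
  exact hmin hy

lemma hasDerivAt_form_flow (v : ℝ × ℝ) (t : ℝ) :
    HasDerivAt (fun t => θ.fn (h.planeFlow t v)) (θ.pairing (h.planeFlow t v)) t := by
  refine ((θ.hasFDerivAt _).comp_hasDerivAt t (h.hasDerivAt_planeFlow t v)).congr_deriv ?_
  simp [PeriodicForm.pairing]

lemma strictMono_form_flow (hθ : ∀ v, 0 < θ.pairing v) (v : ℝ × ℝ) :
    StrictMono fun t => θ.fn (h.planeFlow t v) :=
  strictMono_of_hasDerivAt_pos (hasDerivAt_form_flow v) fun _ => hθ _

lemma surjective_form_flow (hθ : ∀ v, 0 < θ.pairing v) (v : ℝ × ℝ) :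
    Function.Surjective fun t => θ.fn (h.planeFlow t v) := by
  obtain ⟨c, hc, hcθ⟩ := exists_pairing_lower_bound hθ
  have hd := hasDerivAt_form_flow (θ := θ) v
  have hdiff : Differentiable ℝ fun t => θ.fn (h.planeFlow t v) := fun t =>
    (hd t).differentiableAt
  have hlow : ∀ s t, s ≤ t →
      c * (t - s) ≤ θ.fn (h.planeFlow t v) - θ.fn (h.planeFlow s v) := by
    intro s t hst
    exact mul_sub_le_image_sub_of_le_deriv hdiff (fun t => by rw [(hd t).deriv]; exact hcθ _) hst
  refine hdiff.continuous.surjective ?_ ?_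
  · refine Filter.tendsto_atTop_mono' _ (f₁ := fun t => θ.fn (h.planeFlow 0 v) + c * t) ?_
      (Filter.tendsto_atTop_add_const_left _ _ (Filter.tendsto_id.const_mul_atTop hc))
    filter_upwards [Filter.eventually_ge_atTop 0] with t ht
    linarith [hlow 0 t ht]
  · refine Filter.tendsto_atBot_mono' _ (f₁ := fun t => θ.fn (h.planeFlow 0 v) + c * t) ?_
      (Filter.tendsto_atBot_add_const_left _ _ (Filter.tendsto_id.const_mul_atBot hc))
    filter_upwards [Filter.eventually_le_atBot 0] with t ht
    linarith [hlow t 0 ht]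

lemma periods_ne_zero (hθ : ∀ v, 0 < θ.pairing v) : ¬(θ.a = 0 ∧ θ.b = 0) := by
  rintro ⟨ha, hb⟩
  have hK : IsCompact (Icc (0 : ℝ) 1 ×ˢ Icc (0 : ℝ) 1) := isCompact_Icc.prod isCompact_Icc
  obtain ⟨w, -, hmax⟩ := hK.exists_isMaxOn ⟨(0, 0), by simp⟩ θ.continuous_fn.continuousOn
  obtain ⟨t, ht⟩ := surjective_form_flow hθ 0 (θ.fn w + 1)
  obtain ⟨y, hy, m, hm⟩ := exists_intVec_mem_square (h.planeFlow t 0)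
  have h1 : θ.fn y ≤ θ.fn w := hmax hy
  simp only [hm, θ.fn_add, ha, hb] at ht
  norm_num at ht
  linarith

/-- A periodic form which is positive on the flow can be normalized to have coprime periods. -/
lemma exists_form_coprime (hθ : ∀ v, 0 < θ.pairing v) :
    ∃ η : PeriodicForm h.vf, (∀ v, 0 < η.pairing v) ∧
      ∃ e : ℤ × ℤ, η.a * e.1 + η.b * e.2 = 1 := by
  obtain ⟨a, ha⟩ := Int.gcd_dvd_left θ.a θ.b
  obtain ⟨b, hb⟩ := Int.gcd_dvd_right θ.a θ.b
  have hg : (Int.gcd θ.a θ.b : ℤ) ≠ 0 := by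
    intro h0
    exact periods_ne_zero hθ (Int.gcd_eq_zero_iff.1 (by exact_mod_cast h0))
  have hbez := Int.gcd_eq_gcd_ab θ.a θ.b
  generalize Int.gcdA θ.a θ.b = e₁ at hbez
  generalize Int.gcdB θ.a θ.b = e₂ at hbez
  generalize Int.gcd θ.a θ.b = g at *
  have hgpos : (0 : ℝ) < g := by
    have : g ≠ 0 := by exact_mod_cast hg
    exact_mod_cast Nat.pos_of_ne_zero this
  have hbez' : a * e₁ + b * e₂ = 1 := by
    apply mul_left_cancel₀ hg
    rw [ha, hb] at hbez
    linear_combination -hbez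
  obtain ⟨K₁, hK₁⟩ := θ.lipschitz₁
  obtain ⟨K₂, hK₂⟩ := θ.lipschitz₂
  have hpair : ∀ v, (g : ℝ)⁻¹ * θ.G₁ v * (h.vf v).1 + (g : ℝ)⁻¹ * θ.G₂ v * (h.vf v).2 =
      (g : ℝ)⁻¹ * θ.pairing v := by
    intro v
    simp only [PeriodicForm.pairing]
    ring
  refine ⟨⟨fun v => (g : ℝ)⁻¹ * θ.fn v, fun v => (g : ℝ)⁻¹ * θ.G₁ v, fun v => (g : ℝ)⁻¹ * θ.G₂ v,
    a, b, fun v => ((θ.hasFDerivAt v).const_mul _).congr_fderiv (by module),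
    ⟨_, (lipschitzWith_smul (g : ℝ)⁻¹).comp hK₁⟩, ⟨_, (lipschitzWith_smul (g : ℝ)⁻¹).comp hK₂⟩,
    fun v m => ?_, fun v => ?_⟩, fun v => ?_, (e₁, e₂), hbez'⟩
  · rw [θ.fn_add, ha, hb]
    push_cast
    field_simp
  · rw [hpair]
    exact mul_nonneg (inv_pos.2 hgpos).le (hθ v).le
  · change 0 < (g : ℝ)⁻¹ * θ.G₁ v * (h.vf v).1 + (g : ℝ)⁻¹ * θ.G₂ v * (h.vf v).2
    rw [hpair]
    exact mul_pos (inv_pos.2 hgpos) (hθ v)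

end C1FlowT2

namespace PeriodicForm

variable {X : ℝ × ℝ → ℝ × ℝ} (θ : PeriodicForm X)

/-- The Hamiltonian vector field, whose integral curves parametrize the level sets. -/
def levelField (v : ℝ × ℝ) : ℝ × ℝ := (-θ.G₂ v, θ.G₁ v)

lemma exists_levelField_lipschitz : ∃ K, LipschitzWith K θ.levelField :=
  ⟨_, θ.lipschitz₂.choose_spec.neg.prodMk θ.lipschitz₁.choose_spec⟩

lemma levelField_add_intVec (v : ℝ × ℝ) (m : ℤ × ℤ) :
    θ.levelField (v + intVec m) = θ.levelField v := by
  simp only [levelField, (θ.differential_add_intVec v m).1, (θ.differential_add_intVec v m).2]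

lemma exists_levelField_bound : ∃ L : NNReal, ∀ v, ‖θ.levelField v‖ ≤ L := by
  have hK : IsCompact (Icc (0 : ℝ) 1 ×ˢ Icc (0 : ℝ) 1) := isCompact_Icc.prod isCompact_Icc
  obtain ⟨C, hC⟩ := hK.exists_bound_of_continuousOn
    θ.exists_levelField_lipschitz.choose_spec.continuous.continuousOn
  refine ⟨C.toNNReal, fun v => ?_⟩
  obtain ⟨y, hy, m, rfl⟩ := exists_intVec_mem_square v
  rw [θ.levelField_add_intVec]
  exact (hC y hy).trans (Real.le_coe_toNNReal C)

lemma exists_levelCurve (y : ℝ × ℝ) :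
    ∃ z : ℝ → ℝ × ℝ, z 0 = y ∧ ∀ s, HasDerivAt z (θ.levelField (z s)) s := by
  obtain ⟨K, hK⟩ := θ.exists_levelField_lipschitz
  obtain ⟨L, hL⟩ := θ.exists_levelField_bound
  exact exists_global_integralCurve hK hL y

variable {θ} {z w : ℝ → ℝ × ℝ}

lemma fn_levelCurve (hz : ∀ s, HasDerivAt z (θ.levelField (z s)) s) (s : ℝ) :
    θ.fn (z s) = θ.fn (z 0) := by
  have hd : ∀ s, HasDerivAt (fun s => θ.fn (z s)) 0 s := fun s =>
    ((θ.hasFDerivAt _).comp_hasDerivAt s (hz s)).congr_deriv (by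
      simp only [levelField, _root_.add_apply, _root_.smul_apply,
        ContinuousLinearMap.coe_fst', ContinuousLinearMap.coe_snd', smul_eq_mul]
      ring)
  exact is_const_of_deriv_eq_zero (fun s => (hd s).differentiableAt) (fun s => (hd s).deriv) s 0

lemma contDiff_levelCurve (hz : ∀ s, HasDerivAt z (θ.levelField (z s)) s) : ContDiff ℝ 1 z := by
  have hdiff : Differentiable ℝ z := fun s => (hz s).differentiableAt
  refine contDiff_one_iff_deriv.2 ⟨hdiff, ?_⟩
  rw [show deriv z = fun s => θ.levelField (z s) from funext fun s => (hz s).deriv]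
  exact θ.exists_levelField_lipschitz.choose_spec.continuous.comp hdiff.continuous

lemma cross_deriv_levelCurve (hz : ∀ s, HasDerivAt z (θ.levelField (z s)) s) (s : ℝ) :
    cross (deriv z s) (X (z s)) = -θ.pairing (z s) := by
  rw [(hz s).deriv]
  simp only [cross, levelField, pairing]
  ring

/-- Two level curves which meet modulo `ℤ²` are translates of each other. -/
lemma levelCurve_translate (hz : ∀ s, HasDerivAt z (θ.levelField (z s)) s)
    (hw : ∀ s, HasDerivAt w (θ.levelField (w s)) s) {s₀ s₁ : ℝ} {k : ℤ × ℤ}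
    (heq : z s₀ = w s₁ + intVec k) (s : ℝ) : z (s + s₀) = w (s + s₁) + intVec k := by
  obtain ⟨K, hK⟩ := θ.exists_levelField_lipschitz
  have hz' : ∀ s, HasDerivAt (fun s => z (s + s₀)) (θ.levelField (z (s + s₀))) s := fun s =>
    (hz (s + s₀)).comp_add_const s s₀
  have hw' : ∀ s, HasDerivAt (fun s => w (s + s₁) + intVec k)
      (θ.levelField (w (s + s₁) + intVec k)) s := fun s => by
    rw [θ.levelField_add_intVec]
    exact ((hw (s + s₁)).comp_add_const s s₁).add_const _
  exact congrFun (integralCurve_unique hK hz' hw' (s₀ := 0) (by simpa using heq)) s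

end PeriodicForm

namespace C1FlowT2

variable {h : C1FlowT2} {θ : PeriodicForm h.vf}

/-- Points of a level set are on different orbits. -/
lemma eq_of_planeFlow_eq (hθ : ∀ v, 0 < θ.pairing v) {p q : ℝ × ℝ} (hpq : θ.fn p = θ.fn q)
    {t t' : ℝ} (heq : h.planeFlow t p = h.planeFlow t' q) : t = t' ∧ p = q := by
  have hp : h.planeFlow (-t' + t) p = q := by rw [h.planeFlow_add, heq, h.planeFlow_neg_self]
  have ht : -t' + t = 0 := by
    apply (strictMono_form_flow hθ p).injective
    simp only [hp, h.planeFlow_zero, hpq]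
  rw [ht, h.planeFlow_zero] at hp
  exact ⟨by linarith, hp⟩

variable {z : ℝ → ℝ × ℝ}

lemma cross_levelCurve_ne_zero (hθ : ∀ v, 0 < θ.pairing v)
    (hz : ∀ s, HasDerivAt z (θ.levelField (z s)) s) (s : ℝ) :
    cross (deriv z s) (h.vf (z s)) ≠ 0 := by
  rw [PeriodicForm.cross_deriv_levelCurve hz]
  exact (neg_neg_of_pos (hθ _)).ne

/-- The orbits through a level curve fill the plane. -/
lemma surjective_flow_levelCurve (hθ : ∀ v, 0 < θ.pairing v)
    (hz : ∀ s, HasDerivAt z (θ.levelField (z s)) s) :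
    Function.Surjective fun p : ℝ × ℝ => h.planeFlow p.2 (z p.1) := by
  have hopen : ∀ {z : ℝ → ℝ × ℝ}, (∀ s, HasDerivAt z (θ.levelField (z s)) s) →
      IsOpen (range fun p : ℝ × ℝ => h.planeFlow p.2 (z p.1)) := fun hz =>
    (h.isOpenMap_flow_curve (PeriodicForm.contDiff_levelCurve hz)
      (cross_levelCurve_ne_zero hθ hz)).isOpen_range
  have hclosed : IsClosed (range fun p : ℝ × ℝ => h.planeFlow p.2 (z p.1)) := by
    rw [← isOpen_compl_iff, isOpen_iff_mem_nhds]
    intro v hv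
    obtain ⟨t, ht⟩ := surjective_form_flow hθ v (θ.fn (z 0))
    obtain ⟨w, hw0, hw⟩ := θ.exists_levelCurve (h.planeFlow t v)
    refine Filter.mem_of_superset ((hopen hw).mem_nhds ⟨(0, -t), ?_⟩) ?_
    · simp only [hw0, h.planeFlow_neg_self]
    · rintro _ ⟨⟨s, r⟩, rfl⟩ ⟨⟨s', r'⟩, heq⟩
      have hlev : θ.fn (z s') = θ.fn (w s) := by
        rw [PeriodicForm.fn_levelCurve hz, PeriodicForm.fn_levelCurve hw, hw0]
        exact ht.symm
      have hzw := (eq_of_planeFlow_eq hθ hlev heq).2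
      have htr := PeriodicForm.levelCurve_translate hz hw (k := 0)
        (by simpa [intVec_zero] using hzw) (-s)
      rw [intVec_zero, add_zero, neg_add_cancel, hw0] at htr
      exact hv ⟨(-s + s', -t), by simp only [htr, h.planeFlow_neg_self]⟩
  exact range_eq_univ.1 (IsClopen.eq_univ ⟨hclosed, hopen hz⟩ (range_nonempty _))

/-- A global section of the lifted flow: the plane is parametrized by flowing a periodic
level curve. -/
structure LevelSection (θ : PeriodicForm h.vf) where
  curve : ℝ → ℝ × ℝ
  contDiff_curve : ContDiff ℝ 1 curve
  cross_ne_zero : ∀ s, cross (deriv curve s) (h.vf (curve s)) ≠ 0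
  fn_curve : ∀ s, θ.fn (curve s) = θ.fn (curve 0)
  curve_add_one : ∀ s, curve (s + 1) = curve s + intVec (-θ.b, θ.a)
  chart : ℝ × ℝ ≃ₜ ℝ × ℝ
  chart_apply : ∀ s t, chart (s, t) = h.planeFlow t (curve s)
  contDiff_chart_symm : ContDiff ℝ 1 chart.symm

lemma nonempty_levelSection (hθ : ∀ v, 0 < θ.pairing v) : Nonempty (LevelSection θ) := by
  obtain ⟨z, -, hz⟩ := θ.exists_levelCurve 0
  obtain ⟨⟨S, t⟩, hS⟩ := surjective_flow_levelCurve hθ hz (z 0 + intVec (-θ.b, θ.a))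
  have hlev : θ.fn (z S) = θ.fn (z 0 + intVec (-θ.b, θ.a)) := by
    rw [θ.fn_add, PeriodicForm.fn_levelCurve hz]
    push_cast
    ring
  have hzS := (eq_of_planeFlow_eq hθ hlev (hS.trans (h.planeFlow_zero _).symm)).2
  have hper : ∀ s, z (s + S) = z s + intVec (-θ.b, θ.a) := fun s => by
    simpa using PeriodicForm.levelCurve_translate hz hz hzS s
  have hn : intVec (-θ.b, θ.a) ≠ 0 := by
    intro h0
    refine periods_ne_zero hθ ⟨?_, ?_⟩
    · simpa [intVec] using congrArg Prod.snd h0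
    · simpa [intVec] using congrArg Prod.fst h0
  have hS0 : S ≠ 0 := by
    rintro rfl
    exact hn (by simpa using hper 0)
  have hperk : ∀ k : ℕ, z (k * S) = z 0 + (k : ℝ) • intVec (-θ.b, θ.a) := by
    intro k
    induction k with
    | zero => simp
    | succ k ih =>
      push_cast
      rw [add_mul, one_mul, hper, ih]
      module
  have hzc : Continuous z := (PeriodicForm.contDiff_levelCurve hz).continuous
  have hzinj : Function.Injective z := by
    intro s s' hss
    by_contra hne
    have hp : Function.Periodic z (s - s') := fun r => by
      have := PeriodicForm.levelCurve_translate hz hz (k := 0)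
        (by simpa [intVec_zero] using hss) (r - s')
      rw [intVec_zero, add_zero, sub_add_cancel] at this
      rw [← this]
      congr 1
      ring
    have hK := hp.compact_of_continuous (sub_ne_zero.2 hne) hzc
    obtain ⟨C, hC⟩ := hK.exists_bound_of_continuousOn continuous_id.continuousOn
    obtain ⟨k, hk⟩ := exists_nat_gt ((C + ‖z 0‖) / ‖intVec (-θ.b, θ.a)‖)
    rw [div_lt_iff₀ (norm_pos_iff.2 hn)] at hk
    have h1 := hC _ (mem_range_self (k * S))
    have h2 : ‖(k : ℝ) • intVec (-θ.b, θ.a)‖ ≤ ‖z (k * S)‖ + ‖z 0‖ := by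
      rw [show (k : ℝ) • intVec (-θ.b, θ.a) = z (k * S) - z 0 by rw [hperk]; abel]
      exact norm_sub_le _ _
    rw [norm_smul, Real.norm_natCast] at h2
    simp only [id] at h1
    linarith
  have hderiv : ∀ s, HasDerivAt (fun s => z (S * s)) (S • deriv z (S * s)) s := fun s => by
    rw [(hz _).deriv]
    exact (hz (S * s)).scomp s (by simpa using (hasDerivAt_id s).const_mul S)
  have hC : ContDiff ℝ 1 fun s => z (S * s) :=
    (PeriodicForm.contDiff_levelCurve hz).comp (contDiff_const.mul contDiff_id)
  have hcross : ∀ s, cross (deriv (fun s => z (S * s)) s) (h.vf (z (S * s))) ≠ 0 := by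
    intro s
    rw [(hderiv s).deriv]
    have : cross (S • deriv z (S * s)) (h.vf (z (S * s))) =
        S * cross (deriv z (S * s)) (h.vf (z (S * s))) := by
      simp only [cross, Prod.smul_fst, Prod.smul_snd, smul_eq_mul]
      ring
    rw [this]
    exact mul_ne_zero hS0 (cross_levelCurve_ne_zero hθ hz _)
  have hbij : Function.Bijective fun p : ℝ × ℝ => h.planeFlow p.2 (z (S * p.1)) := by
    constructor
    · rintro ⟨s, t⟩ ⟨s', t'⟩ heq
      obtain ⟨rfl, hs⟩ := eq_of_planeFlow_eq hθ (θ := θ)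
        (by rw [PeriodicForm.fn_levelCurve hz, PeriodicForm.fn_levelCurve hz (S * s')]) heq
      exact Prod.ext (mul_left_cancel₀ hS0 (hzinj hs)) rfl
    · intro v
      obtain ⟨⟨s, t⟩, hst⟩ := surjective_flow_levelCurve hθ hz v
      refine ⟨(s / S, t), ?_⟩
      simp only [mul_div_cancel₀ s hS0]
      exact hst
  have hcd : ContDiff ℝ 1 fun p : ℝ × ℝ => h.planeFlow p.2 (z (S * p.1)) :=
    h.contDiff_planeFlow.comp (contDiff_snd.prodMk (hC.comp contDiff_fst))
  choose A hA using h.exists_equiv_hasFDerivAt hC hcross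
  refine ⟨⟨fun s => z (S * s), hC, hcross, fun s => ?_, fun s => ?_,
    (Equiv.ofBijective _ hbij).toHomeomorphOfContinuousOpen hcd.continuous
      (h.isOpenMap_flow_curve hC hcross), fun s t => rfl,
    Homeomorph.contDiff_symm _ hA hcd⟩⟩
  · rw [PeriodicForm.fn_levelCurve hz, PeriodicForm.fn_levelCurve hz (S * 0)]
  · rw [mul_add, mul_one, hper]

end C1FlowT2

namespace C1FlowT2.LevelSection

variable {h : C1FlowT2} {θ : PeriodicForm h.vf} (σ : LevelSection θ)

lemma injective_curve : Function.Injective σ.curve := by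
  intro s s' hs
  have heq : σ.chart (s, 0) = σ.chart (s', 0) := by simp only [σ.chart_apply, hs]
  exact congrArg Prod.fst (σ.chart.injective heq)

lemma curve_add_int (s : ℝ) (j : ℤ) :
    σ.curve (s + j) = σ.curve s + intVec (j * -θ.b, j * θ.a) := by
  have hp : Function.Periodic (fun s => σ.curve s - s • intVec (-θ.b, θ.a)) 1 := fun s => by
    simp only [σ.curve_add_one]
    module
  have hj := hp.int_mul j s
  simp only [mul_one] at hj
  have hv : intVec (j * -θ.b, j * θ.a) = (j : ℝ) • intVec (-θ.b, θ.a) := by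
    ext <;> simp [intVec]
  rw [hv, ← sub_eq_zero, ← sub_eq_zero.2 hj]
  module

/-- Two points of the curve agree on the torus only if their parameters differ by an integer. -/
lemma exists_eq_add_int {e : ℤ × ℤ} (he : θ.a * e.1 + θ.b * e.2 = 1) {s s' : ℝ}
    (hs : projT2 (σ.curve s) = projT2 (σ.curve s')) : ∃ j : ℤ, s = s' + j := by
  obtain ⟨m, hm⟩ := projT2_eq_iff.1 hs
  have hlev := congrArg θ.fn hm
  rw [θ.fn_add, σ.fn_curve s, σ.fn_curve s'] at hlev
  have h0 : θ.a * m.1 + θ.b * m.2 = 0 := by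
    have : (θ.a * m.1 + θ.b * m.2 : ℝ) = 0 := by linarith
    exact_mod_cast this
  refine ⟨e.1 * m.2 - e.2 * m.1, σ.injective_curve ?_⟩
  rw [σ.curve_add_int, hm]
  congr 2
  ext
  · linear_combination e.1 * h0 - m.1 * he
  · linear_combination e.2 * h0 - m.2 * he

/-- The parameter of the point of the curve on the orbit of `curve s + intVec m`. -/
def holonomy (m : ℤ × ℤ) (s : ℝ) : ℝ := (σ.chart.symm (σ.curve s + intVec m)).1

/-- The time needed to reach `curve s + intVec m` from the curve. -/
def hitTime (m : ℤ × ℤ) (s : ℝ) : ℝ := (σ.chart.symm (σ.curve s + intVec m)).2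

lemma planeFlow_hitTime (m : ℤ × ℤ) (s : ℝ) :
    h.planeFlow (σ.hitTime m s) (σ.curve (σ.holonomy m s)) = σ.curve s + intVec m := by
  rw [← σ.chart_apply]
  exact σ.chart.apply_symm_apply _

lemma eq_of_planeFlow_curve {m : ℤ × ℤ} {r s t : ℝ}
    (heq : h.planeFlow t (σ.curve r) = σ.curve s + intVec m) :
    σ.holonomy m s = r ∧ σ.hitTime m s = t := by
  have : σ.chart.symm (σ.curve s + intVec m) = (r, t) := by
    rw [← heq, ← σ.chart_apply, σ.chart.symm_apply_apply]
  exact ⟨congrArg Prod.fst this, congrArg Prod.snd this⟩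

lemma planeFlow_neg_hitTime (m : ℤ × ℤ) (s : ℝ) :
    h.planeFlow (-σ.hitTime m s) (σ.curve s) = σ.curve (σ.holonomy m s) + intVec (-m) := by
  have h1 := congrArg (h.planeFlow (-σ.hitTime m s)) (σ.planeFlow_hitTime m s)
  rw [h.planeFlow_neg_self, h.planeFlow_add_intVec] at h1
  rw [h1, intVec_neg]
  abel

lemma leftInverse_holonomy (m : ℤ × ℤ) (s : ℝ) : σ.holonomy (-m) (σ.holonomy m s) = s :=
  (σ.eq_of_planeFlow_curve (σ.planeFlow_neg_hitTime m s)).1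

lemma add_one (m : ℤ × ℤ) (s : ℝ) :
    σ.holonomy m (s + 1) = σ.holonomy m s + 1 ∧ σ.hitTime m (s + 1) = σ.hitTime m s := by
  refine σ.eq_of_planeFlow_curve ?_
  rw [σ.curve_add_one, σ.curve_add_one, h.planeFlow_add_intVec, σ.planeFlow_hitTime]
  abel

lemma contDiff_holonomy (m : ℤ × ℤ) : ContDiff ℝ 1 (σ.holonomy m) :=
  contDiff_fst.comp (σ.contDiff_chart_symm.comp (σ.contDiff_curve.add contDiff_const))

lemma contDiff_hitTime (m : ℤ × ℤ) : ContDiff ℝ 1 (σ.hitTime m) :=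
  contDiff_snd.comp (σ.contDiff_chart_symm.comp (σ.contDiff_curve.add contDiff_const))

lemma monotone_holonomy (m : ℤ × ℤ) : Monotone (σ.holonomy m) := by
  rcases (σ.contDiff_holonomy m).continuous.strictMono_of_inj
    (Function.LeftInverse.injective (σ.leftInverse_holonomy m)) with hmono | hanti
  · exact hmono.monotone
  · have h1 := hanti (show (0 : ℝ) < 0 + 1 by norm_num)
    rw [(σ.add_one m 0).1] at h1
    linarith

/-- The holonomy as a lift of a circle map of degree one. -/
def holonomyLift (m : ℤ × ℤ) : CircleDeg1Lift :=
  ⟨⟨σ.holonomy m, σ.monotone_holonomy m⟩, fun s => (σ.add_one m s).1⟩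

lemma holonomyLift_mul (m : ℤ × ℤ) : σ.holonomyLift (-m) * σ.holonomyLift m = 1 :=
  CircleDeg1Lift.ext fun s => σ.leftInverse_holonomy m s

/-- The holonomy as an invertible lift of a circle map of degree one. -/
def holonomyUnit (m : ℤ × ℤ) : CircleDeg1Liftˣ where
  val := σ.holonomyLift m
  inv := σ.holonomyLift (-m)
  val_inv := by simpa using σ.holonomyLift_mul (-m)
  inv_val := σ.holonomyLift_mul m

/-- The form grows by exactly one between consecutive visits to the transversal. -/
lemma fn_first_hit {e : ℤ × ℤ} (he : θ.a * e.1 + θ.b * e.2 = 1) (s : ℝ) :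
    θ.fn (h.planeFlow (-σ.hitTime (-e) s) (σ.curve s)) = θ.fn (σ.curve 0) + 1 := by
  rw [σ.planeFlow_neg_hitTime, θ.fn_add, σ.fn_curve, neg_neg]
  congr 1
  exact_mod_cast he

lemma hitTime_negative {e : ℤ × ℤ} (he : θ.a * e.1 + θ.b * e.2 = 1)
    (hθ : ∀ v, 0 < θ.pairing v) (s : ℝ) : 0 < -σ.hitTime (-e) s := by
  apply (strictMono_form_flow hθ (σ.curve s)).lt_iff_lt.1
  simp only [σ.fn_first_hit he, h.planeFlow_zero, σ.fn_curve s]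
  linarith

/-- The closed transversal of the torus obtained by projecting the level curve. -/
def transversal {e : ℤ × ℤ} (he : θ.a * e.1 + θ.b * e.2 = 1) : ClosedTransversal h where
  γ := Function.Periodic.lift (f := fun s => projT2 (σ.curve s)) (c := 1) fun s => by
    simp only [σ.curve_add_one, projT2_add_intVec]
  lift := σ.curve
  lift_contDiff := σ.contDiff_curve
  lift_proj _ := rfl
  inj := by
    intro x y hxy
    obtain ⟨s, rfl⟩ := QuotientAddGroup.mk_surjective x
    obtain ⟨s', rfl⟩ := QuotientAddGroup.mk_surjective y
    obtain ⟨j, rfl⟩ := σ.exists_eq_add_int he hxy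
    have hj : ((j : ℝ) : AddCircle (1 : ℝ)) = 0 :=
      (AddCircle.coe_eq_zero_iff (1 : ℝ)).2 ⟨j, by simp⟩
    change ((s' + j : ℝ) : AddCircle (1 : ℝ)) = s'
    rw [AddCircle.coe_add, hj, add_zero]
  transverse := σ.cross_ne_zero
  meets := by
    intro x
    obtain ⟨v, rfl⟩ := projT2_surjective x
    refine ⟨-(σ.chart.symm v).2, ((σ.chart.symm v).1 : ℝ), ?_⟩
    have hv : h.planeFlow (σ.chart.symm v).2 (σ.curve (σ.chart.symm v).1) = v := by
      rw [← σ.chart_apply]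
      exact σ.chart.apply_symm_apply v
    change projT2 (σ.curve (σ.chart.symm v).1) = _
    rw [← h.projT2_planeFlow, ← h.planeFlow_neg_self (σ.chart.symm v).2 (σ.curve _), hv]

variable {e : ℤ × ℤ} (he : θ.a * e.1 + θ.b * e.2 = 1)

lemma transversal_coe (s : ℝ) : (σ.transversal he).γ s = projT2 (σ.curve s) := rfl

lemma mem_range_transversal {v : ℝ × ℝ} : projT2 v ∈ range (σ.transversal he).γ ↔
    ∃ (s : ℝ) (m : ℤ × ℤ), v = σ.curve s + intVec m := by
  constructor
  · rintro ⟨y, hy⟩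
    obtain ⟨s, rfl⟩ := QuotientAddGroup.mk_surjective y
    exact ⟨s, projT2_eq_iff.1 hy.symm⟩
  · rintro ⟨s, m, rfl⟩
    exact ⟨s, by rw [transversal_coe, projT2_add_intVec]⟩

lemma isLeast_returnTime (hθ : ∀ v, 0 < θ.pairing v) (s : ℝ) :
    IsLeast {t : ℝ | 0 < t ∧ h.flow t ((σ.transversal he).γ s) ∈ range (σ.transversal he).γ}
      (-σ.hitTime (-e) s) := by
  simp only [transversal_coe, ← h.projT2_planeFlow, mem_range_transversal]
  refine ⟨⟨σ.hitTime_negative he hθ s, _, _, σ.planeFlow_neg_hitTime (-e) s⟩, ?_⟩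
  rintro t ⟨ht, s', m, hm⟩
  apply (strictMono_form_flow hθ (σ.curve s)).le_iff_le.1
  have hlt := strictMono_form_flow hθ (σ.curve s) ht
  simp only [σ.fn_first_hit he, hm, h.planeFlow_zero, θ.fn_add, σ.fn_curve s, σ.fn_curve s']
    at hlt ⊢
  have h1 : 0 < θ.a * m.1 + θ.b * m.2 := by
    have : (0 : ℝ) < θ.a * m.1 + θ.b * m.2 := by linarith
    exact_mod_cast this
  have h2 : (1 : ℝ) ≤ θ.a * m.1 + θ.b * m.2 := by exact_mod_cast h1
  linarith

lemma returnTime_transversal (hθ : ∀ v, 0 < θ.pairing v) (s : ℝ) :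
    returnTime h (σ.transversal he) ((σ.transversal he).γ s) = -σ.hitTime (-e) s :=
  (σ.isLeast_returnTime he hθ s).csInf_eq

end C1FlowT2.LevelSection

/-- Existence of a closed transversal for a `C¹` flow on `𝕋²` without critical points
and periodic orbits, with first return time finite, positive, `C¹`, bounded above and
away from `0`, and first return map a `C¹` circle diffeomorphism. -/
theorem exists_closed_transversal (h : C1FlowT2)
    (hcrit : h.NoCriticalPoints) (hper : h.NoPeriodicOrbits) :
    ∃ Γ : ClosedTransversal h,
      (∀ x ∈ Set.range Γ.γ,
        0 < returnTime h Γ x ∧ h.flow (returnTime h Γ x) x ∈ Set.range Γ.γ) ∧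
      (∃ m M : ℝ, 0 < m ∧
        ∀ x ∈ Set.range Γ.γ, m ≤ returnTime h Γ x ∧ returnTime h Γ x ≤ M) ∧
      ContDiff ℝ 1 (fun s : ℝ => returnTime h Γ (Γ.γ ↑s)) ∧
      ∃ F : CircleDeg1Liftˣ, ReturnMapLift h Γ (F : CircleDeg1Lift) ∧
        ContDiff ℝ 1 ⇑(F : CircleDeg1Lift) ∧
        ContDiff ℝ 1 ⇑((F⁻¹ : CircleDeg1Liftˣ) : CircleDeg1Lift) := by
  obtain ⟨θ₀, hθ₀⟩ := exists_positive_form h.continuous_vf h.vf_add_intVec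
    (h.exists_arc_through hcrit hper)
  obtain ⟨θ, hθ, e, he⟩ := C1FlowT2.exists_form_coprime hθ₀
  obtain ⟨σ⟩ := C1FlowT2.nonempty_levelSection hθ
  have hret := σ.returnTime_transversal he hθ
  have hrange : ∀ {p : T2 → Prop}, (∀ s : ℝ, p ((σ.transversal he).γ s)) →
      ∀ x ∈ Set.range (σ.transversal he).γ, p x := by
    rintro p hp _ ⟨y, rfl⟩
    obtain ⟨s, rfl⟩ := QuotientAddGroup.mk_surjective y
    exact hp s
  have hflow : ∀ s : ℝ, (σ.transversal he).γ (σ.holonomy (-e) s : ℝ) =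
      h.flow (-σ.hitTime (-e) s) ((σ.transversal he).γ s) := by
    intro s
    rw [σ.transversal_coe, σ.transversal_coe, ← h.projT2_planeFlow, σ.planeFlow_neg_hitTime,
      projT2_add_intVec]
  have hcont : ContDiff ℝ 1 fun s => -σ.hitTime (-e) s := (σ.contDiff_hitTime (-e)).neg
  refine ⟨σ.transversal he, hrange fun s => ?_, ?_, ?_, σ.holonomyUnit (-e), fun s => ?_,
    σ.contDiff_holonomy (-e), σ.contDiff_holonomy (-(-e))⟩
  · rw [hret]
    exact ⟨σ.hitTime_negative he hθ s, _, hflow s⟩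
  · have hp : Function.Periodic (fun s => -σ.hitTime (-e) s) 1 := fun s => by
      simp only [(σ.add_one (-e) s).2]
    have hK := hp.compact_of_continuous one_ne_zero hcont.continuous
    obtain ⟨_, ⟨s₀, rfl⟩, hmin⟩ := hK.exists_isLeast (Set.range_nonempty _)
    obtain ⟨M, -, hmax⟩ := hK.exists_isGreatest (Set.range_nonempty _)
    refine ⟨_, M, σ.hitTime_negative he hθ s₀, hrange fun s => ?_⟩
    rw [hret]
    exact ⟨hmin ⟨s, rfl⟩, hmax ⟨s, rfl⟩⟩
  · simpa only [hret] using hcont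
  · rw [hret]
    exact hflow s
end
end

section
/- Let e ∈ ℝ² be a unit vector of irrational slope, and let v be a bounded Lipschitz continuous vector field on 𝕋² = ℝ²/ℤ² satisfying ⟨v(x), e⟩ = 1 for all x, with generated flow h_t. Suppose there exist a homeomorphism f : 𝕋² → 𝕋² and a constant c with 0 < c < 1 such that f ∘ h_t = h_{ct} ∘ f for all t ∈ ℝ. Then the flow h_t has no periodic orbit. -/
open MeasureTheory Set
noncomputable section

/-- Real numbers at distance less than `1` with the same projection to the circle are equal. -/
lemma eq_of_addCircle_coe_eq {a b : ℝ} (hab : (a : AddCircle (1 : ℝ)) = b) (hlt : |a - b| < 1) :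
    a = b := by
  have h0 : ((a - b : ℝ) : AddCircle (1 : ℝ)) = 0 := by
    rw [AddCircle.coe_sub, hab, sub_self]
  obtain ⟨n, hn⟩ := (AddCircle.coe_eq_zero_iff (1 : ℝ)).1 h0
  rw [zsmul_one] at hn
  rw [← hn, ← Int.cast_abs] at hlt
  have hn0 : n = 0 := Int.abs_lt_one_iff.1 (by exact_mod_cast hlt)
  rw [hn0, Int.cast_zero] at hn
  linarith

/-- Points of the plane at sup-distance less than `1` with the same projection are equal. -/
lemma eq_of_projT2_eq_s10 {u v : ℝ × ℝ} (huv : projT2 u = projT2 v) (hlt : ‖u - v‖ < 1) : u = v := by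
  have hmax := max_lt_iff.1 ((Prod.norm_def (u - v)).symm.trans_lt hlt)
  exact Prod.ext (eq_of_addCircle_coe_eq (congrArg Prod.fst huv) hmax.1)
    (eq_of_addCircle_coe_eq (congrArg Prod.snd huv) hmax.2)

/-- An integral curve of a field with unit component along `e` advances at unit speed along `e`. -/
lemma component_integralCurve {e : ℝ × ℝ} {V : ℝ × ℝ → ℝ × ℝ}
    (hcomp : ∀ v, (V v).1 * e.1 + (V v).2 * e.2 = 1) {γ : ℝ → ℝ × ℝ}
    (hγ : ∀ t, HasDerivAt γ (V (γ t)) t) (t : ℝ) :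
    (γ t).1 * e.1 + (γ t).2 * e.2 = (γ 0).1 * e.1 + (γ 0).2 * e.2 + t := by
  have hderiv (s : ℝ) :
      HasDerivAt (fun r => (γ r).1 * e.1 + (γ r).2 * e.2 - r) 0 s := by
    have h1 : HasDerivAt (fun r => (γ r).1) (V (γ s)).1 s :=
      (ContinuousLinearMap.fst ℝ ℝ ℝ).hasFDerivAt.comp_hasDerivAt s (hγ s)
    have h2 : HasDerivAt (fun r => (γ r).2) (V (γ s)).2 s :=
      (ContinuousLinearMap.snd ℝ ℝ ℝ).hasFDerivAt.comp_hasDerivAt s (hγ s)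
    have h3 := ((h1.mul_const e.1).add (h2.mul_const e.2)).sub (hasDerivAt_id s)
    rw [hcomp, sub_self] at h3
    exact h3
  have hconst := is_const_of_deriv_eq_zero (fun s => (hderiv s).differentiableAt)
    (fun s => (hderiv s).deriv) t 0
  linarith

/-- An integral curve of a field bounded by `C`, with unit component along some vector, cannot
close up on the torus in a positive time less than `1 / C`. -/
lemma one_le_mul_of_projT2_eq {e : ℝ × ℝ} {V : ℝ × ℝ → ℝ × ℝ} {C : ℝ} (hC : ∀ v, ‖V v‖ ≤ C)
    (hcomp : ∀ v, (V v).1 * e.1 + (V v).2 * e.2 = 1) {γ : ℝ → ℝ × ℝ}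
    (hγ : ∀ t, HasDerivAt γ (V (γ t)) t) {T : ℝ} (hT : 0 < T)
    (hper : projT2 (γ T) = projT2 (γ 0)) : 1 ≤ C * T := by
  by_contra! hlt
  have hdisp : ‖γ T - γ 0‖ ≤ C * ‖T - 0‖ :=
    convex_univ.norm_image_sub_le_of_norm_hasDerivWithin_le
      (fun t _ => (hγ t).hasDerivWithinAt) (fun t _ => hC (γ t)) (mem_univ 0) (mem_univ T)
  rw [sub_zero, Real.norm_of_nonneg hT.le] at hdisp
  have hadv := component_integralCurve hcomp hγ T
  rw [eq_of_projT2_eq_s10 hper (hdisp.trans_lt hlt)] at hadv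
  linarith

/-- **Absence of periodic orbits for contracted flows.** Let `e` be a unit vector of
irrational slope and `v` a bounded Lipschitz vector field on `𝕋²` (given by a
ℤ²-periodic lift `V`) with `⟨v(x), e⟩ = 1` everywhere, generating the flow `h_t`.
If a homeomorphism `f` of `𝕋²` satisfies `f ∘ h_t = h_{ct} ∘ f` with `0 < c < 1`,
then `h_t` has no periodic orbit. -/
theorem no_periodic_orbit_of_renormalization
    (e : ℝ × ℝ) (hunit : e.1 ^ 2 + e.2 ^ 2 = 1)
    (hslope : ∀ m : ℤ × ℤ, m ≠ 0 → (m.1 : ℝ) * e.1 + (m.2 : ℝ) * e.2 ≠ 0)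
    (V : ℝ × ℝ → ℝ × ℝ) (K : NNReal) (hlip : LipschitzWith K V)
    (hVper : ∀ (v : ℝ × ℝ) (m : ℤ × ℤ), V (v + ((m.1 : ℝ), (m.2 : ℝ))) = V v)
    (hbdd : ∃ C : ℝ, ∀ v, ‖V v‖ ≤ C)
    (hcomp : ∀ v, (V v).1 * e.1 + (V v).2 * e.2 = 1)
    (H : ℝ → ℝ × ℝ → ℝ × ℝ)
    (hH0 : ∀ v, H 0 v = v)
    (hHderiv : ∀ v t, HasDerivAt (fun s => H s v) (V (H t v)) t)
    (h : ℝ → T2 → T2)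
    (hproj : ∀ (t : ℝ) (v : ℝ × ℝ), h t (projT2 v) = projT2 (H t v))
    (f : T2 ≃ₜ T2) (c : ℝ) (hc0 : 0 < c) (hc1 : c < 1)
    (hconj : ∀ (t : ℝ) (x : T2), f (h t x) = h (c * t) (f x)) :
    ∀ (x : T2) (T : ℝ), 0 < T → h T x ≠ x := by
  obtain ⟨C, hC⟩ := hbdd
  have hmin (x : T2) (T : ℝ) (hT : 0 < T) (hx : h T x = x) : 1 ≤ C * T := by
    obtain ⟨⟨a, ha⟩, ⟨b, hb⟩⟩ :=
      And.intro (QuotientAddGroup.mk_surjective x.1) (QuotientAddGroup.mk_surjective x.2)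
    have hv : projT2 (a, b) = x := Prod.ext ha hb
    refine one_le_mul_of_projT2_eq hC hcomp (hHderiv (a, b)) hT ?_
    rw [← hproj, hH0, hv, hx]
  intro x T hT hx
  have hiter (n : ℕ) : h (c ^ n * T) (f^[n] x) = f^[n] x := by
    induction n with
    | zero => simpa using hx
    | succ n ih =>
      rw [Function.iterate_succ_apply', pow_succ', mul_assoc, ← hconj, ih]
  have hlim : Filter.Tendsto (fun n : ℕ => C * (c ^ n * T)) Filter.atTop (nhds 0) := by
    simpa using ((tendsto_pow_atTop_nhds_zero_of_lt_one hc0.le hc1).mul_const T).const_mul C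
  obtain ⟨n, hn⟩ := (hlim.eventually (gt_mem_nhds one_pos)).exists
  exact hn.not_ge (hmin _ _ (by positivity) (hiter n))
end
end
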